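/- arXiv:1411.0963 — 3 statements merged into one kernel-verified Lean document; each statement's English description precedes it below -/
import Mathlib

section
/- For every s with 1/2 < s < 1 there exists C = C(s) > 0 such that for all k ∈ ℤ and all Schwartz φ : ℝ → ℂ, ‖ψ_k φ̂‖_{L^∞_ξ} ≤ C(‖P_kφ‖_{L²_x} + 2^{−sk}(‖φ‖_{L²_x} + ‖x∂_xφ‖_{L²_x})), where P_k is the Littlewood–Paley projection with symbol ψ_k. -/
open MeasureTheory FourierTransform Real

/-- Plancherel's theorem for Schwartz functions, in terms of `eLpNorm`. -/
theorem SchwartzMap.eLpNorm_fourier_two (f : SchwartzMap ℝ ℂ) :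
    eLpNorm (𝓕 (⇑f)) 2 volume = eLpNorm (⇑f) 2 volume := by
  obtain ⟨g, hg⟩ : ∃ g : SchwartzMap ℝ ℂ, 𝓕 f = g := ⟨_, rfl⟩
  have h := f.norm_fourier_toL2_eq
  rw [hg, SchwartzMap.norm_toLp, SchwartzMap.norm_toLp] at h
  rw [← SchwartzMap.fourier_coe, hg]
  exact (ENNReal.toReal_eq_toReal_iff' (g.memLp 2 volume).2.ne (f.memLp 2 volume).2.ne).1 h

theorem SchwartzMap.eLpNorm_fourierInv_two (f : SchwartzMap ℝ ℂ) :
    eLpNorm (𝓕⁻ (⇑f)) 2 volume = eLpNorm (⇑f) 2 volume := by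
  have h := (𝓕⁻ f).eLpNorm_fourier_two
  rw [← SchwartzMap.fourier_coe, FourierTransform.fourier_fourierInv_eq,
    SchwartzMap.fourierInv_coe] at h
  exact h.symm

theorem SchwartzMap.exists_coe_eq_mul (f : SchwartzMap ℝ ℂ) :
    ∃ g : SchwartzMap ℝ ℂ, ⇑g = fun x : ℝ ↦ (x : ℂ) * f x :=
  ⟨SchwartzMap.smulLeftCLM ℂ (fun x : ℝ ↦ (x : ℂ)) f,
    SchwartzMap.smulLeftCLM_apply (by fun_prop) f⟩

theorem SchwartzMap.exists_coe_eq_mul_deriv (f : SchwartzMap ℝ ℂ) :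
    ∃ g : SchwartzMap ℝ ℂ, ⇑g = fun x : ℝ ↦ (x : ℂ) * deriv (⇑f) x :=
  (SchwartzMap.derivCLM ℝ ℂ f).exists_coe_eq_mul

theorem SchwartzMap.mul_deriv_fourier (f : SchwartzMap ℝ ℂ) (ξ : ℝ) :
    (ξ : ℂ) * deriv (𝓕 (⇑f)) ξ = -𝓕 (fun x : ℝ ↦ f x + (x : ℂ) * deriv (⇑f) x) ξ := by
  obtain ⟨g, hgx⟩ := f.exists_coe_eq_mul
  have hd : deriv (⇑g) = fun x : ℝ ↦ f x + (x : ℂ) * deriv (⇑f) x := by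
    ext x
    rw [hgx]
    have h := (Complex.ofRealCLM.hasDerivAt (x := x)).mul (f.differentiableAt (x := x)).hasDerivAt
    simpa using! h.deriv
  have hgd : Integrable (deriv (⇑g)) := (SchwartzMap.derivCLM ℝ ℂ g).integrable
  have h₁ := Real.deriv_fourier f.integrable (f := ⇑f) (by
    simpa [hgx] using! g.integrable (μ := volume))
  have h₂ := Real.fourier_deriv g.integrable g.differentiable hgd
  rw [← hd, h₂, h₁]
  have h₃ : (fun x : ℝ ↦ (-2 * π * Complex.I * x : ℂ) • f x) =
      ⇑((-2 * π * Complex.I : ℂ) • g) := by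
    ext x; simp [hgx, mul_assoc]
  rw [h₃, ← SchwartzMap.fourier_coe, FourierTransform.fourier_smul, ← SchwartzMap.fourier_coe,
    smul_apply]
  simp only [smul_eq_mul]
  ring

theorem SchwartzMap.eLpNorm_mul_deriv_fourier_two_le (f : SchwartzMap ℝ ℂ) :
    eLpNorm (fun ξ : ℝ ↦ (ξ : ℂ) * deriv (𝓕 (⇑f)) ξ) 2 volume ≤
      eLpNorm (⇑f) 2 volume + eLpNorm (fun x : ℝ ↦ (x : ℂ) * deriv (⇑f) x) 2 volume := by
  obtain ⟨h, hh⟩ := f.exists_coe_eq_mul_deriv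
  have e : (fun ξ : ℝ ↦ (ξ : ℂ) * deriv (𝓕 (⇑f)) ξ) = -𝓕 (⇑(f + h)) := by
    ext ξ
    have hs : ⇑(f + h) = fun x : ℝ ↦ f x + (x : ℂ) * deriv (⇑f) x := by
      ext x; rw [add_apply, hh]
    rw [f.mul_deriv_fourier, hs, Pi.neg_apply]
  rw [e, eLpNorm_neg, SchwartzMap.eLpNorm_fourier_two, ← hh]
  exact eLpNorm_add_le f.continuous.aestronglyMeasurable h.continuous.aestronglyMeasurable
    (by norm_num)

/-- Agmon's inequality on the line for compactly supported functions. -/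
theorem enorm_sq_le_eLpNorm_two_mul_eLpNorm_deriv {F : ℝ → ℂ} (hF : ContDiff ℝ 1 F)
    (hc : HasCompactSupport F) (x : ℝ) :
    ‖F x‖ₑ ^ 2 ≤ 2 * (eLpNorm F 2 volume * eLpNorm (deriv F) 2 volume) := by
  have hd : ∀ y, deriv (fun y ↦ F y * F y) y = 2 * (F y * deriv F y) := fun y ↦ by
    have h := (hF.differentiable one_ne_zero y).hasDerivAt
    rw [(h.fun_mul h).deriv]; ring
  have hm : Measurable fun y ↦ ‖F y‖ₑ := hF.continuous.enorm.measurable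
  have hm' : Measurable fun y ↦ ‖deriv F y‖ₑ := (hF.continuous_deriv le_rfl).enorm.measurable
  calc ‖F x‖ₑ ^ 2 = ‖F x * F x‖ₑ := by rw [enorm_mul, sq]
    _ ≤ ∫⁻ y in Set.Iic x, ‖deriv (fun y ↦ F y * F y) y‖ₑ :=
      HasCompactSupport.enorm_le_lintegral_Ici_deriv (hF.mul hF) (hc.mul_left) x
    _ ≤ ∫⁻ y, ‖deriv (fun y ↦ F y * F y) y‖ₑ := setLIntegral_le_lintegral _ _
    _ = 2 * ∫⁻ y, ((fun y ↦ ‖F y‖ₑ) * fun y ↦ ‖deriv F y‖ₑ) y := by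
      rw [← lintegral_const_mul _ (hm.mul hm')]
      refine lintegral_congr fun y ↦ ?_
      rw [hd, enorm_mul, enorm_mul]
      congr 1
      simp [← ofReal_norm]
    _ ≤ _ := by
      gcongr
      have := ENNReal.lintegral_mul_le_Lp_mul_Lq volume Real.HolderConjugate.two_two
        (f := fun y ↦ ‖F y‖ₑ) (g := fun y ↦ ‖deriv F y‖ₑ) hm.aemeasurable hm'.aemeasurable
      simpa [eLpNorm_eq_lintegral_rpow_enorm_toReal] using this

theorem abs_sub_le_one_of_mem_Icc {a b : ℝ} (ha : a ∈ Set.Icc (0 : ℝ) 1)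
    (hb : b ∈ Set.Icc (0 : ℝ) 1) : |a - b| ≤ 1 :=
  abs_le.2 ⟨by linarith [ha.1, hb.2], by linarith [ha.2, hb.1]⟩

theorem abs_sub_dilate_le {ψ : ℝ → ℝ} (hψ : ∀ x, ψ x ∈ Set.Icc (0 : ℝ) 1)
    (hψ_one : ∀ x : ℝ, |x| ≤ 1 → ψ x = 1) {r : ℝ} (hr : 0 < r) (ξ : ℝ) :
    |ψ (ξ / r) - ψ (ξ / (r / 2))| ≤ 2 / r * |ξ| := by
  rcases le_or_gt |ξ| (r / 2) with h | h
  · rw [hψ_one (ξ / r), hψ_one (ξ / (r / 2)), sub_self, abs_zero]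
    · positivity
    · rw [abs_div, abs_of_pos (half_pos hr), div_le_one (half_pos hr)]; exact h
    · rw [abs_div, abs_of_pos hr, div_le_one hr]; linarith
  · refine (abs_sub_le_one_of_mem_Icc (hψ _) (hψ _)).trans ?_
    rw [div_mul_eq_mul_div, one_le_div hr]
    linarith

theorem exists_hasDerivAt_sub_dilate {ψ : ℝ → ℝ} (hψ : Differentiable ℝ ψ) {M : ℝ}
    (hM : ∀ x, |deriv ψ x| ≤ M) {r : ℝ} (hr : 0 < r) (ξ : ℝ) :
    ∃ d : ℝ, HasDerivAt (fun ξ ↦ ψ (ξ / r) - ψ (ξ / (r / 2))) d ξ ∧ |d| ≤ 3 * M / r := by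
  have hd : ∀ a : ℝ, HasDerivAt (fun ξ ↦ ψ (ξ / a)) (deriv ψ (ξ / a) * (1 / a)) ξ := fun a ↦
    (hψ (ξ / a)).hasDerivAt.comp ξ ((hasDerivAt_id ξ).div_const a)
  refine ⟨_, (hd r).sub (hd (r / 2)), ?_⟩
  refine (abs_sub _ _).trans ?_
  rw [abs_mul, abs_mul, abs_of_pos (one_div_pos.2 hr), abs_of_pos (one_div_pos.2 (half_pos hr))]
  calc _ ≤ M * (1 / r) + M * (1 / (r / 2)) := by
        gcongr
        · exact hM _
        · exact hM _
    _ = _ := by field_simp; ring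

/-- The elementary inequality that turns the interpolation bound `N² ≲ P · A / 2ᵏ` with `P ≤ A`
into a linear one. -/
theorem mul_div_two_zpow_le_sq {s P A : ℝ} (hs₁ : 1 / 2 < s) (hs₂ : s < 1) (hP : 0 ≤ P)
    (hPA : P ≤ A) (k : ℤ) :
    P * (A / 2 ^ k) ≤ (P + (2 : ℝ) ^ (-s * k) * A) ^ 2 := by
  have hA := hP.trans hPA
  have h2 : A / 2 ^ k = (2 : ℝ) ^ (-(k : ℝ)) * A := by
    rw [Real.rpow_neg two_pos.le, Real.rpow_intCast]; ring
  rw [h2]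
  have hq : 0 ≤ (2 : ℝ) ^ (-s * k) * A := by positivity
  rcases le_or_gt 0 k with hk | hk
  · have hk' : (0 : ℝ) ≤ k := by exact_mod_cast hk
    have : (2 : ℝ) ^ (-(k : ℝ)) * A ≤ (2 : ℝ) ^ (-s * k) * A := by
      gcongr
      · norm_num
      · nlinarith
    nlinarith [mul_le_mul_of_nonneg_left this hP]
  · have hk' : (k : ℝ) < 0 := by exact_mod_cast hk
    have h₁ : (2 : ℝ) ^ (-(k : ℝ)) ≤ (2 : ℝ) ^ (-s * k) * (2 : ℝ) ^ (-s * k) := by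
      rw [← Real.rpow_add two_pos]
      apply Real.rpow_le_rpow_of_exponent_le (by norm_num)
      nlinarith
    calc P * ((2 : ℝ) ^ (-(k : ℝ)) * A) ≤ A * ((2 : ℝ) ^ (-s * k) * (2 : ℝ) ^ (-s * k) * A) := by
          gcongr
      _ = ((2 : ℝ) ^ (-s * k) * A) ^ 2 := by ring
      _ ≤ _ := by gcongr; linarith

/-- Lemma 2.2: pointwise bound on `ψ_k φ̂` in terms of `‖P_kφ‖_{L²}`
and the weighted norms of `φ`, for `1/2 < s < 1`. -/
theorem linfty_localized_fourier_bound
    (ψ : ℝ → ℝ) (hψ_smooth : ContDiff ℝ (⊤ : ℕ∞) ψ) (hψ_supp : HasCompactSupport ψ)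
    (hψ_nonneg : ∀ x, 0 ≤ ψ x) (hψ_le_one : ∀ x, ψ x ≤ 1)
    (hψ_supp' : Function.support ψ ⊆ Set.Ioo (-2) 2)
    (hψ_one : ∀ x : ℝ, |x| ≤ 1 → ψ x = 1)
    (hψ_even : ∀ x : ℝ, ψ (-x) = ψ x)
    (s : ℝ) (hs₁ : 1 / 2 < s) (hs₂ : s < 1) :
    ∃ C > 0, ∀ (k : ℤ) (φ : SchwartzMap ℝ ℂ),
      eLpNorm (fun ξ : ℝ =>
          ((ψ (ξ / 2 ^ k) - ψ (ξ / 2 ^ (k - 1)) : ℝ) : ℂ) * 𝓕 (⇑φ) ξ) ⊤ volume ≤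
        ENNReal.ofReal C *
          (eLpNorm (𝓕⁻ (fun η : ℝ =>
              ((ψ (η / 2 ^ k) - ψ (η / 2 ^ (k - 1)) : ℝ) : ℂ) * 𝓕 (⇑φ) η)) 2 volume +
            ENNReal.ofReal ((2 : ℝ) ^ (-s * k)) *
              (eLpNorm (⇑φ) 2 volume +
                eLpNorm (fun x : ℝ => (x : ℂ) * deriv (⇑φ) x) 2 volume)) := by
  obtain ⟨M, hM⟩ := (hψ_smooth.continuous_deriv (by simp)).bounded_above_of_compact_support
    hψ_supp.deriv
  have hM0 : 0 ≤ M := (norm_nonneg _).trans (hM 0)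
  have hD : 0 < 3 * M + 2 := by positivity
  refine ⟨3 * M + 2, hD, fun k φ ↦ ?_⟩
  have hr : (0 : ℝ) < 2 ^ k := by positivity
  rw [zpow_sub_one₀ (two_ne_zero' ℝ), ← div_eq_mul_inv]
  set r : ℝ := 2 ^ k
  set m : ℝ → ℝ := fun ξ ↦ ψ (ξ / r) - ψ (ξ / (r / 2))
  have hm_smooth : ContDiff ℝ (⊤ : ℕ∞) m := by
    have h (a : ℝ) : ContDiff ℝ (⊤ : ℕ∞) fun ξ : ℝ ↦ ψ (ξ / a) :=
      hψ_smooth.comp (contDiff_id.div_const a)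
    exact (h r).sub (h (r / 2))
  have hm_supp : HasCompactSupport m := by
    have h {a : ℝ} (ha : 0 < a) : HasCompactSupport fun ξ : ℝ ↦ ψ (ξ / a) :=
      hψ_supp.comp_homeomorph (Homeomorph.mulRight₀ a⁻¹ (inv_ne_zero ha.ne'))
    exact (h hr).sub (h (half_pos hr))
  have hmC_supp : HasCompactSupport fun ξ ↦ (m ξ : ℂ) := hm_supp.comp_left Complex.ofReal_zero
  have hmC_smooth : ContDiff ℝ (⊤ : ℕ∞) fun ξ ↦ (m ξ : ℂ) :=
    Complex.ofRealCLM.contDiff.comp hm_smooth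
  set g : SchwartzMap ℝ ℂ := 𝓕 φ
  have hg : ⇑g = 𝓕 (⇑φ) := SchwartzMap.fourier_coe φ
  set F : SchwartzMap ℝ ℂ := SchwartzMap.smulLeftCLM ℂ (fun ξ ↦ (m ξ : ℂ)) g
  have hF : ⇑F = fun ξ ↦ (m ξ : ℂ) * 𝓕 (⇑φ) ξ := by
    rw [← hg]
    exact SchwartzMap.smulLeftCLM_apply (hmC_supp.hasTemperateGrowth hmC_smooth) g
  have hF_supp : HasCompactSupport (⇑F) := hF ▸ hmC_supp.mul_right
  change eLpNorm (fun ξ : ℝ ↦ (m ξ : ℂ) * 𝓕 (⇑φ) ξ) ⊤ volume ≤ ENNReal.ofReal (3 * M + 2) *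
    (eLpNorm (𝓕⁻ (fun ξ : ℝ ↦ (m ξ : ℂ) * 𝓕 (⇑φ) ξ)) 2 volume + _)
  rw [← hF, F.eLpNorm_fourierInv_two]
  set A := eLpNorm (⇑φ) 2 volume + eLpNorm (fun x : ℝ => (x : ℂ) * deriv (⇑φ) x) 2 volume
    with hA_def
  have hψ_mem (x : ℝ) : ψ x ∈ Set.Icc (0 : ℝ) 1 := ⟨hψ_nonneg x, hψ_le_one x⟩
  have hg_eLp : eLpNorm (⇑g) 2 volume = eLpNorm (⇑φ) 2 volume := by
    rw [hg, φ.eLpNorm_fourier_two]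
  have hA_top : A ≠ ⊤ := by
    obtain ⟨h, hh⟩ := φ.exists_coe_eq_mul_deriv
    rw [hA_def, ← hh]
    exact ENNReal.add_ne_top.2 ⟨(φ.memLp 2 volume).2.ne, (h.memLp 2 volume).2.ne⟩
  have hFA : eLpNorm (⇑F) 2 volume ≤ A := by
    refine le_trans ?_ (le_self_add (a := eLpNorm (⇑φ) 2 volume))
    rw [← hg_eLp]
    refine eLpNorm_mono fun ξ ↦ ?_
    rw [hF, ← hg, norm_mul, Complex.norm_real]
    exact mul_le_of_le_one_left (norm_nonneg _) (abs_sub_le_one_of_mem_Icc (hψ_mem _) (hψ_mem _))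
  have hF'A : eLpNorm (deriv (⇑F)) 2 volume ≤ ENNReal.ofReal ((3 * M + 2) / r) * A := by
    set G : ℝ → ℂ := fun ξ ↦ (ξ : ℂ) * deriv (𝓕 (⇑φ)) ξ with hG
    have hG_le : eLpNorm G 2 volume ≤ A := φ.eLpNorm_mul_deriv_fourier_two_le
    have hG_meas : AEStronglyMeasurable G volume := by
      rw [hG, ← hg]
      exact (Complex.continuous_ofReal.mul
        (SchwartzMap.derivCLM ℝ ℂ g).continuous).aestronglyMeasurable
    have hpt (ξ : ℝ) : ‖deriv (⇑F) ξ‖ ≤ (3 * M / r) • ‖g ξ‖ + (2 / r) • ‖G ξ‖ := by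
      obtain ⟨d, hd, hd_le⟩ := exists_hasDerivAt_sub_dilate
        (hψ_smooth.differentiable (by simp)) hM hr ξ
      have h := hd.ofReal_comp.fun_mul (g.differentiableAt (x := ξ)).hasDerivAt
      rw [hF, ← hg, h.deriv]
      refine (norm_add_le _ _).trans ?_
      rw [norm_mul, norm_mul, hG, ← hg, norm_mul, Complex.norm_real, Complex.norm_real,
        Complex.norm_real, smul_eq_mul, smul_eq_mul, ← mul_assoc]
      gcongr
      · exact hd_le
      · exact abs_sub_dilate_le hψ_mem hψ_one hr ξ
    calc eLpNorm (deriv (⇑F)) 2 volume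
        ≤ eLpNorm ((3 * M / r) • (fun ξ ↦ ‖g ξ‖) + (2 / r) • fun ξ ↦ ‖G ξ‖) 2 volume :=
          eLpNorm_mono_real hpt
      _ ≤ eLpNorm ((3 * M / r) • fun ξ ↦ ‖g ξ‖) 2 volume +
            eLpNorm ((2 / r) • fun ξ ↦ ‖G ξ‖) 2 volume :=
          eLpNorm_add_le (g.continuous.norm.aestronglyMeasurable.const_smul _)
            (hG_meas.norm.const_smul _) (by norm_num)
      _ = ENNReal.ofReal (3 * M / r) * eLpNorm (⇑φ) 2 volume +
            ENNReal.ofReal (2 / r) * eLpNorm G 2 volume := by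
          rw [eLpNorm_const_smul, eLpNorm_const_smul, eLpNorm_norm, eLpNorm_norm, hg_eLp,
            Real.enorm_of_nonneg (by positivity), Real.enorm_of_nonneg (by positivity)]
      _ ≤ ENNReal.ofReal (3 * M / r) * A + ENNReal.ofReal (2 / r) * A := by
          gcongr
          exact le_self_add
      _ = _ := by
          rw [← add_mul, ← ENNReal.ofReal_add (by positivity) (by positivity), add_div]
  have hF_top : eLpNorm (⇑F) 2 volume ≠ ⊤ := ne_top_of_le_ne_top hA_top hFA
  rw [eLpNorm_exponent_top]
  refine eLpNormEssSup_le_of_ae_enorm_bound (.of_forall fun ξ ↦ ?_)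
  have hN := (enorm_sq_le_eLpNorm_two_mul_eLpNorm_deriv (F.smooth 1) hF_supp ξ).trans
    (mul_le_mul_right (mul_le_mul_right hF'A _) 2)
  obtain ⟨a, ha⟩ : ∃ a, A.toReal = a := ⟨_, rfl⟩
  obtain ⟨p, hp⟩ : ∃ p, (eLpNorm (⇑F) 2 volume).toReal = p := ⟨_, rfl⟩
  have hp0 : 0 ≤ p := hp ▸ ENNReal.toReal_nonneg
  have ha0 : 0 ≤ a := ha ▸ ENNReal.toReal_nonneg
  have hpa : p ≤ a := by rw [← ha, ← hp]; exact ENNReal.toReal_mono hA_top hFA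
  rw [← ENNReal.ofReal_toReal hA_top, ← ENNReal.ofReal_toReal hF_top, ha, hp] at hN ⊢
  rw [← ofReal_norm] at hN ⊢
  rw [← ENNReal.ofReal_mul (by positivity), ← ENNReal.ofReal_add hp0 (by positivity),
    ← ENNReal.ofReal_mul hD.le]
  rw [← ENNReal.ofReal_mul (by positivity), ← ENNReal.ofReal_mul hp0,
    ← ENNReal.ofReal_pow (norm_nonneg _), ← ENNReal.ofReal_ofNat, ← ENNReal.ofReal_mul (by simp),
    ENNReal.ofReal_le_ofReal_iff (by positivity)] at hN
  refine ENNReal.ofReal_le_ofReal (abs_le_of_sq_le_sq' ?_ (by positivity)).2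
  have hkey := mul_div_two_zpow_le_sq hs₁ hs₂ hp0 hpa k
  calc ‖F ξ‖ ^ 2 ≤ 2 * (p * ((3 * M + 2) / r * a)) := hN
    _ = 2 * (3 * M + 2) * (p * (a / r)) := by ring
    _ ≤ (3 * M + 2) * (3 * M + 2) * (p + (2 : ℝ) ^ (-s * k) * a) ^ 2 := by
      gcongr
      linarith
    _ = _ := by ring
end

section
/- Let Φ(ξ) = |ξ|^{1/2}. There exists C > 0 such that for every Schwartz function φ : ℝ → ℂ and every t ∈ ℝ, ‖e^{itΦ(D)}φ‖_{L^∞_x(ℝ)} ≤ C(1+|t|)^{−1/2}(‖φ‖_{H¹_x(ℝ)} + ‖x ∂_x φ‖_{L²_x(ℝ)}). -/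
open MeasureTheory FourierTransform Real Complex

/-- First-derivative (non-stationary phase) bound for the phase `A * (a - β * a ^ 2 / 2)`. -/
lemma norm_integral_quadratic_phase_le {h h' : ℝ → ℂ} (hd : ∀ a, HasDerivAt h (h' a) a)
    (hc : Continuous h') {A β m K p q : ℝ} (hpq : p ≤ q) (hA : A ≠ 0) (hm : 0 < m)
    (hlow : ∀ a ∈ Set.Icc p q, m ≤ |1 - β * a|) (hK : ∀ a ∈ Set.Icc p q, ‖h a‖ ≤ K) :
    ‖∫ a in p..q, cexp (I * ((A * (a - β * a ^ 2 / 2) : ℝ) : ℂ)) * h a‖ ≤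
      (4 * K + ∫ a in p..q, ‖h' a‖) / (|A| * m) := by
  have hA' : 0 < |A| := abs_pos.2 hA
  have hne : ∀ a ∈ Set.Icc p q, 1 - β * a ≠ 0 := fun a ha h0 => by
    have := hlow a ha
    rw [h0, abs_zero] at this
    linarith
  have hK0 : 0 ≤ K := (norm_nonneg _).trans (hK p ⟨le_rfl, hpq⟩)
  have hcont : Continuous h := continuous_iff_continuousAt.2 fun a => (hd a).continuousAt
  set e : ℝ → ℂ := fun a => cexp (I * ((A * (a - β * a ^ 2 / 2) : ℝ) : ℂ)) with he
  have hecont : Continuous e := by rw [he]; fun_prop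
  have hnorm : ∀ a, ‖e a‖ = 1 := fun a => by
    simp only [he]; rw [mul_comm]; exact Complex.norm_exp_ofReal_mul_I _
  set w : ℝ → ℝ := fun a => (A * (1 - β * a))⁻¹ with hw
  have hwnorm : ∀ a ∈ Set.Icc p q, |w a| ≤ (|A| * m)⁻¹ := fun a ha => by
    simp only [hw, abs_inv, abs_mul]
    exact inv_anti₀ (by positivity) (by gcongr; exact hlow a ha)
  have hwd : ∀ a ∈ Set.Icc p q, HasDerivAt w (β / (A * (1 - β * a) ^ 2)) a := fun a ha => by
    have h1 : HasDerivAt (fun a => A * (1 - β * a)) (A * (-(β * 1))) a :=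
      (((hasDerivAt_id a).const_mul β).const_sub 1).const_mul A
    refine (h1.inv (mul_ne_zero hA (hne a ha))).congr_deriv ?_
    have := hne a ha
    field_simp
  have hwcont : ContinuousOn w (Set.Icc p q) := fun a ha =>
    (hwd a ha).continuousAt.continuousWithinAt
  have hed : ∀ a, HasDerivAt e (e a * (I * ((A * (1 - β * a) : ℝ) : ℂ))) a := fun a => by
    have h1 : HasDerivAt (fun a : ℝ => A * (a - β * a ^ 2 / 2)) (A * (1 - β * a)) a := by
      refine (((hasDerivAt_id' a).sub
        (((hasDerivAt_pow 2 a).const_mul β).div_const 2)).const_mul A).congr_deriv ?_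
      simp only [Nat.cast_ofNat, Nat.add_one_sub_one, pow_one]
      ring
    exact (h1.ofReal_comp.const_mul I).cexp
  set w' : ℝ → ℝ := fun a => β / (A * (1 - β * a) ^ 2) with hw'
  have hw'cont : ContinuousOn w' (Set.Icc p q) := by
    refine ContinuousOn.div continuousOn_const (by fun_prop) fun a ha => ?_
    exact mul_ne_zero hA (pow_ne_zero _ (hne a ha))
  set R : ℝ → ℂ := fun a => e a * (-I) * (h' a * w a + h a * w' a) with hR
  have hRcont : ContinuousOn R (Set.Icc p q) := by
    refine ContinuousOn.mul (by fun_prop) (ContinuousOn.add ?_ ?_)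
    · exact hc.continuousOn.mul (continuous_ofReal.comp_continuousOn hwcont)
    · exact hcont.continuousOn.mul (continuous_ofReal.comp_continuousOn hw'cont)
  have hGd : ∀ a ∈ Set.uIcc p q,
      HasDerivAt (fun a => e a * (-I) * (h a * w a)) (e a * h a + R a) a := fun a ha => by
    rw [Set.uIcc_of_le hpq] at ha
    refine (((hed a).mul_const (-I)).mul ((hd a).mul (hwd a ha).ofReal_comp)).congr_deriv ?_
    simp only [hR, hw, hw']
    have h1 : (1 - (β : ℂ) * a) ≠ 0 := by exact_mod_cast hne a ha
    have h2 : (A : ℂ) ≠ 0 := by exact_mod_cast hA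
    have h3 : (I : ℂ) ^ 2 = -1 := I_sq
    push_cast
    have h4 : e a * (I * (A * (1 - β * a))) * (-I) * (h a * ((A : ℂ) * (1 - β * a))⁻¹) =
        e a * h a := by
      field_simp
      linear_combination (-(e a * h a)) * h3
    rw [Pi.mul_apply, h4]
  have hii : IntervalIntegrable (fun a => e a * h a) volume p q :=
    (hecont.mul hcont).intervalIntegrable _ _
  have hiR : IntervalIntegrable R volume p q := by
    apply ContinuousOn.intervalIntegrable
    rwa [Set.uIcc_of_le hpq]
  have hFTC := intervalIntegral.integral_eq_sub_of_hasDerivAt hGd (hii.add hiR)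
  rw [intervalIntegral.integral_add hii hiR] at hFTC
  have hbd : ∀ a ∈ Set.Icc p q, ‖e a * (-I) * (h a * w a)‖ ≤ K * (|A| * m)⁻¹ := fun a ha => by
    simp only [norm_mul, hnorm, norm_neg, norm_I, one_mul, norm_real, Real.norm_eq_abs]
    exact mul_le_mul (hK a ha) (hwnorm a ha) (abs_nonneg _) hK0
  obtain ⟨s, hs, hsβ⟩ : ∃ s : ℝ, |s| = 1 ∧ |β / A| = s * (β / A) := by
    rcases abs_cases (β / A) with h1 | h1
    · exact ⟨1, by simp, by rw [h1.1, one_mul]⟩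
    · exact ⟨-1, by simp, by rw [h1.1]; ring⟩
  have hw'int : IntervalIntegrable w' volume p q := by
    apply ContinuousOn.intervalIntegrable
    rwa [Set.uIcc_of_le hpq]
  have hw'abs : ∀ a, |w' a| = s * w' a := fun a => by
    have : w' a = β / A * ((1 - β * a) ^ 2)⁻¹ := by simp only [hw']; rw [← div_div]; rfl
    rw [this, abs_mul, hsβ, abs_of_nonneg (a := ((1 - β * a) ^ 2)⁻¹) (by positivity)]
    ring
  have hFTCw : ∫ a in p..q, w' a = w q - w p := by
    refine intervalIntegral.integral_eq_sub_of_hasDerivAt (fun a ha => hwd a ?_) hw'int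
    rwa [Set.uIcc_of_le hpq] at ha
  have hRbd : ‖∫ a in p..q, R a‖ ≤
      ∫ a in p..q, (‖h' a‖ * (|A| * m)⁻¹ + K * s * w' a) := by
    refine intervalIntegral.norm_integral_le_of_norm_le hpq ?_ ?_
    · refine Filter.Eventually.of_forall fun a ha => ?_
      have ha' : a ∈ Set.Icc p q := ⟨ha.1.le, ha.2⟩
      simp only [hR, norm_mul, hnorm, norm_neg, norm_I, one_mul]
      refine (norm_add_le _ _).trans ?_
      simp only [norm_mul, norm_real, Real.norm_eq_abs]
      rw [mul_assoc K, ← hw'abs]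
      gcongr
      · exact hwnorm a ha'
      · exact hK a ha'
    · exact (hc.norm.intervalIntegrable _ _ |>.mul_const _).add (hw'int.const_mul _)
  rw [intervalIntegral.integral_add (hc.norm.intervalIntegrable _ _ |>.mul_const _)
    (hw'int.const_mul _), intervalIntegral.integral_mul_const,
    intervalIntegral.integral_const_mul, hFTCw] at hRbd
  have hsw : s * (w q - w p) ≤ 2 * (|A| * m)⁻¹ := by
    have h1 := hwnorm p ⟨le_rfl, hpq⟩
    have h2 := hwnorm q ⟨hpq, le_rfl⟩
    calc s * (w q - w p) ≤ |s * (w q - w p)| := le_abs_self _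
      _ = |w q - w p| := by rw [abs_mul, hs, one_mul]
      _ ≤ |w q| + |w p| := abs_sub _ _
      _ ≤ _ := by linarith
  have hKsw := mul_le_mul_of_nonneg_left hsw hK0
  have hp := hbd p ⟨le_rfl, hpq⟩
  have hq := hbd q ⟨hpq, le_rfl⟩
  have hmain : ∫ a in p..q, e a * h a =
      e q * (-I) * (h q * w q) - e p * (-I) * (h p * w p) - ∫ a in p..q, R a := by
    rw [← hFTC]; ring
  rw [hmain, div_eq_mul_inv]
  refine (norm_sub_le _ _).trans ?_
  have := norm_sub_le (e q * (-I) * (h q * w q)) (e p * (-I) * (h p * w p))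
  nlinarith

/-- To bound an integral over `[x, y]` clipped to `[p, q]`, it suffices to bound the integrals over
the subintervals of `[x, y] ∩ [p, q]`. -/
lemma norm_integral_clip_le {F : ℝ → ℂ} {p q x y B : ℝ} (hpq : p ≤ q) (hxy : x ≤ y) (hB : 0 ≤ B)
    (H : ∀ u v, p ≤ u → u ≤ v → v ≤ q → x ≤ u → v ≤ y → ‖∫ a in u..v, F a‖ ≤ B) :
    ‖∫ a in (max p (min q x))..(max p (min q y)), F a‖ ≤ B := by
  have hmono : max p (min q x) ≤ max p (min q y) := by gcongr
  rcases hmono.eq_or_lt with h | h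
  · rw [h, intervalIntegral.integral_same, norm_zero]
    exact hB
  · have hx : x ≤ max p (min q x) := by
      by_contra! hx
      have h1 := max_lt_iff.1 hx
      rcases le_total q x with h2 | h2
      · rw [min_eq_left h2, min_eq_left (h2.trans hxy)] at h
        exact lt_irrefl _ h
      · rw [min_eq_right h2] at h1
        exact lt_irrefl _ h1.2
    have hy : max p (min q y) ≤ y := by
      refine max_le ?_ (min_le_right _ _)
      by_contra! hy
      rw [max_eq_left ((min_le_right _ _).trans hy.le)] at h
      exact absurd h (not_lt.2 (le_max_left _ _))
    exact H _ _ (le_max_left _ _) hmono (max_le hpq (min_le_left _ _)) hx hy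

/-- Decay of the oscillatory integral with quadratic phase on the frequency window `[T⁻¹, T]`. -/
lemma norm_integral_quadratic_phase_decay {h h' : ℝ → ℂ} (hd : ∀ a, HasDerivAt h (h' a) a)
    (hc : Continuous h') {A β K T : ℝ} (hT : 1 ≤ T) (hA : |A| = T ^ 2) (hK0 : 0 ≤ K)
    (hK : ∀ a, 0 < a → ‖h a‖ ≤ K) (hK' : ∀ a, 0 < a → a * ‖h a‖ ≤ K)
    (hV : ∀ x y, 0 < x → x ≤ y → ∫ a in x..y, ‖h' a‖ ≤ K * √(y / x)) :
    ‖∫ a in T⁻¹..T, cexp (I * ((A * (a - β * a ^ 2 / 2) : ℝ) : ℂ)) * h a‖ ≤ 41 * K / T := by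
  have hT0 : 0 < T := by linarith
  have hA0 : A ≠ 0 := by
    intro h0
    rw [h0, abs_zero] at hA
    exact (pow_pos hT0 2).ne hA
  have hTi : T⁻¹ ≤ 1 := inv_le_one_of_one_le₀ hT
  have hpq : T⁻¹ ≤ T := hTi.trans hT
  have hp0 : 0 < T⁻¹ := by positivity
  have hTT : T * T⁻¹ = 1 := mul_inv_cancel₀ hT0.ne'
  have hcont : Continuous h := continuous_iff_continuousAt.2 fun a => (hd a).continuousAt
  set F : ℝ → ℂ := fun a => cexp (I * ((A * (a - β * a ^ 2 / 2) : ℝ) : ℂ)) * h a with hF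
  have hFcont : Continuous F := by rw [hF]; fun_prop
  have hFnorm : ∀ a, ‖F a‖ = ‖h a‖ := fun a => by
    simp only [hF, norm_mul]
    rw [mul_comm I, Complex.norm_exp_ofReal_mul_I, one_mul]
  have key : ∀ u v m r : ℝ, T⁻¹ ≤ u → u ≤ v → 0 < m → 0 ≤ r →
      (∀ a ∈ Set.Icc u v, m ≤ |1 - β * a|) → v ≤ r ^ 2 * u →
      ‖∫ a in u..v, F a‖ ≤ K * (4 + r) / (T ^ 2 * m) := by
    intro u v m r hu huv hm hr hlow hvr
    have hu0 : 0 < u := hp0.trans_le hu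
    refine (norm_integral_quadratic_phase_le hd hc huv hA0 hm hlow
      (fun a ha => hK a (hu0.trans_le ha.1))).trans ?_
    rw [hA]
    gcongr
    have h1 : √(v / u) ≤ r := by
      rw [Real.sqrt_le_left hr, div_le_iff₀ hu0]
      exact hvr
    have h2 := (hV u v hu0 huv).trans (mul_le_mul_of_nonneg_left h1 hK0)
    linarith
  have hfull : ∀ u v, T⁻¹ ≤ u → v ≤ T → v ≤ T ^ 2 * u := fun u v hu hv => by
    calc v ≤ T := hv
      _ = T ^ 2 * T⁻¹ := by field_simp
      _ ≤ T ^ 2 * u := by gcongr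
  rcases le_or_gt β 0 with hβ | hβ
  · refine (key T⁻¹ T 1 T le_rfl hpq one_pos hT0.le (fun a ha => ?_)
      (hfull _ _ le_rfl le_rfl)).trans ?_
    · have : β * a ≤ 0 := mul_nonpos_of_nonpos_of_nonneg hβ (hp0.le.trans ha.1)
      exact le_trans (by linarith) (le_abs_self _)
    · rw [div_le_div_iff₀ (by positivity) hT0]
      nlinarith [mul_nonneg hK0 hT0.le, mul_nonneg (mul_nonneg hK0 hT0.le) (sub_nonneg.2 hT)]
  set b := β⁻¹ with hb
  have hb0 : 0 < b := by positivity
  have hβb : β * b = 1 := mul_inv_cancel₀ hβ.ne'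
  have hβs : ∀ s : ℝ, β * (b * s) = s := fun s => by rw [← mul_assoc, hβb, one_mul]
  have hKT : 0 ≤ K / T := by positivity
  set c : ℝ → ℝ := fun x => max T⁻¹ (min T x) with hcl
  have hc0 : c 0 = T⁻¹ := by
    simp only [hcl]
    rw [min_eq_right hT0.le, max_eq_left hp0.le]
  have hcT : c (b * 2 + T) = T := by
    simp only [hcl]
    rw [min_eq_left (by linarith), max_eq_right hpq]
  have e1 : ‖∫ a in c 0..c (b * (1 / 2)), F a‖ ≤ 10 * (K / T) := by
    refine norm_integral_clip_le hpq (by positivity) (by positivity)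
      fun u v hu huv hv hx hy => ?_
    refine (key u v (1 / 2) T hu huv (by norm_num) hT0.le (fun a ha => ?_)
      (hfull _ _ hu hv)).trans ?_
    · have := mul_le_mul_of_nonneg_left (ha.2.trans hy) hβ.le
      rw [hβs] at this
      exact le_trans (by linarith) (le_abs_self _)
    · rw [mul_div_assoc' 10 K T, div_le_div_iff₀ (by positivity) hT0]
      nlinarith [mul_nonneg (mul_nonneg hK0 hT0.le) (sub_nonneg.2 hT)]
  have e2 : ‖∫ a in c (b * (1 / 2))..c (b * (1 - T⁻¹ / 2)), F a‖ ≤ 12 * (K / T) := by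
    refine norm_integral_clip_le hpq (by gcongr; linarith) (by positivity)
      fun u v hu huv hv hx hy => ?_
    refine (key u v (T⁻¹ / 2) 2 hu huv (by positivity) (by norm_num) (fun a ha => ?_) ?_).trans ?_
    · have := mul_le_mul_of_nonneg_left (ha.2.trans hy) hβ.le
      rw [hβs] at this
      exact le_trans (by linarith) (le_abs_self _)
    · nlinarith
    · apply le_of_eq
      field_simp
      ring
  have e3 : ‖∫ a in c (b * (1 - T⁻¹ / 2))..c (b * (1 + T⁻¹ / 2)), F a‖ ≤ 2 * (K / T) := by
    refine norm_integral_clip_le hpq (by gcongr; linarith) (by positivity)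
      fun u v hu huv hv hx hy => ?_
    have hu2 : b / 2 ≤ u := by nlinarith
    refine (intervalIntegral.norm_integral_le_of_norm_le_const (C := 2 * K / b)
      fun a ha => ?_).trans ?_
    · rw [Set.uIoc_of_le huv] at ha
      have ha2 : b / 2 ≤ a := hu2.trans ha.1.le
      rw [hFnorm, le_div_iff₀ hb0]
      have := hK' a (by linarith)
      nlinarith [norm_nonneg (h a)]
    · rw [abs_of_nonneg (sub_nonneg.2 huv)]
      have : v - u ≤ b * T⁻¹ := by linarith
      calc 2 * K / b * (v - u) ≤ 2 * K / b * (b * T⁻¹) := by gcongr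
        _ = 2 * (K / T) := by field_simp
  have e4 : ‖∫ a in c (b * (1 + T⁻¹ / 2))..c (b * 2), F a‖ ≤ 12 * (K / T) := by
    refine norm_integral_clip_le hpq (by gcongr; linarith) (by positivity)
      fun u v hu huv hv hx hy => ?_
    refine (key u v (T⁻¹ / 2) 2 hu huv (by positivity) (by norm_num) (fun a ha => ?_) ?_).trans ?_
    · have := mul_le_mul_of_nonneg_left (hx.trans ha.1) hβ.le
      rw [hβs] at this
      exact le_trans (by linarith) (neg_le_abs _)
    · nlinarith
    · apply le_of_eq
      field_simp
      ring
  have e5 : ‖∫ a in c (b * 2)..c (b * 2 + T), F a‖ ≤ 5 * (K / T) := by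
    refine norm_integral_clip_le hpq (by linarith) (by positivity)
      fun u v hu huv hv hx hy => ?_
    refine (key u v 1 T hu huv one_pos hT0.le (fun a ha => ?_) (hfull _ _ hu hv)).trans ?_
    · have := mul_le_mul_of_nonneg_left (hx.trans ha.1) hβ.le
      rw [hβs] at this
      exact le_trans (by linarith) (neg_le_abs _)
    · rw [mul_div_assoc' 5 K T, div_le_div_iff₀ (by positivity) hT0]
      nlinarith [mul_nonneg (mul_nonneg hK0 hT0.le) (sub_nonneg.2 hT)]
  have hi : ∀ u v, IntervalIntegrable F volume u v := fun u v => hFcont.intervalIntegrable u v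
  have hsplit : ∫ a in T⁻¹..T, F a = (∫ a in c 0..c (b * (1 / 2)), F a) +
      (∫ a in c (b * (1 / 2))..c (b * (1 - T⁻¹ / 2)), F a) +
      (∫ a in c (b * (1 - T⁻¹ / 2))..c (b * (1 + T⁻¹ / 2)), F a) +
      (∫ a in c (b * (1 + T⁻¹ / 2))..c (b * 2), F a) +
      ∫ a in c (b * 2)..c (b * 2 + T), F a := by
    rw [intervalIntegral.integral_add_adjacent_intervals (hi _ _) (hi _ _),
      intervalIntegral.integral_add_adjacent_intervals (hi _ _) (hi _ _),
      intervalIntegral.integral_add_adjacent_intervals (hi _ _) (hi _ _),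
      intervalIntegral.integral_add_adjacent_intervals (hi _ _) (hi _ _), hc0, hcT]
  rw [hsplit, mul_div_assoc]
  refine (norm_add_le _ _).trans ?_
  refine (add_le_add_left ((norm_add_le _ _).trans (add_le_add_left ((norm_add_le _ _).trans
    (add_le_add_left (norm_add_le _ _) _)) _)) _).trans ?_
  linarith

lemma intervalIntegral_le_setIntegral_Ioi {g : ℝ → ℝ} (hg : ∀ ξ, 0 ≤ g ξ)
    (hi : IntegrableOn g (Set.Ioi 0)) {x y : ℝ} (hx : 0 ≤ x) (hxy : x ≤ y) :
    ∫ ξ in x..y, g ξ ≤ ∫ ξ in Set.Ioi 0, g ξ := by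
  rw [intervalIntegral.integral_of_le hxy]
  exact setIntegral_mono_set hi (Filter.Eventually.of_forall hg)
    (LE.le.eventuallyLE fun ξ hξ => hx.trans_lt hξ.1)

/-- Square-integrability of `f`, `ξ f` and `ξ f'` on the positive half-line, with `L²` norms
at most `N`. -/
structure HalfLineBound (f f' : ℝ → ℂ) (N : ℝ) : Prop where
  hasDerivAt : ∀ ξ, HasDerivAt f (f' ξ) ξ
  continuous_deriv : Continuous f'
  integrable : IntegrableOn (fun ξ => ‖f ξ‖ ^ 2) (Set.Ioi 0)
  integral_le : ∫ ξ in Set.Ioi 0, ‖f ξ‖ ^ 2 ≤ N ^ 2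
  integrable_mul : IntegrableOn (fun ξ => (ξ * ‖f ξ‖) ^ 2) (Set.Ioi 0)
  integral_mul_le : ∫ ξ in Set.Ioi 0, (ξ * ‖f ξ‖) ^ 2 ≤ N ^ 2
  integrable_mul_deriv : IntegrableOn (fun ξ => (ξ * ‖f' ξ‖) ^ 2) (Set.Ioi 0)
  integral_mul_deriv_le : ∫ ξ in Set.Ioi 0, (ξ * ‖f' ξ‖) ^ 2 ≤ N ^ 2

namespace HalfLineBound

variable {f f' : ℝ → ℂ} {N : ℝ}

lemma continuous (H : HalfLineBound f f' N) : Continuous f :=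
  continuous_iff_continuousAt.2 fun ξ => (H.hasDerivAt ξ).continuousAt

lemma intervalIntegral_le (H : HalfLineBound f f' N) {x y : ℝ} (hx : 0 ≤ x) (hxy : x ≤ y) :
    ∫ ξ in x..y, ‖f ξ‖ ^ 2 ≤ N ^ 2 :=
  (intervalIntegral_le_setIntegral_Ioi (fun _ => by positivity) H.integrable hx hxy).trans
    H.integral_le

lemma intervalIntegral_mul_le (H : HalfLineBound f f' N) {x y : ℝ} (hx : 0 ≤ x) (hxy : x ≤ y) :
    ∫ ξ in x..y, (ξ * ‖f ξ‖) ^ 2 ≤ N ^ 2 :=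
  (intervalIntegral_le_setIntegral_Ioi (fun _ => by positivity) H.integrable_mul hx hxy).trans
    H.integral_mul_le

lemma intervalIntegral_mul_deriv_le (H : HalfLineBound f f' N) {x y : ℝ} (hx : 0 ≤ x)
    (hxy : x ≤ y) : ∫ ξ in x..y, (ξ * ‖f' ξ‖) ^ 2 ≤ N ^ 2 :=
  (intervalIntegral_le_setIntegral_Ioi (fun _ => by positivity) H.integrable_mul_deriv hx
    hxy).trans H.integral_mul_deriv_le

lemma mul_norm_sq_le (H : HalfLineBound f f' N) {x : ℝ} (hx : 0 ≤ x) :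
    x * ‖f x‖ ^ 2 ≤ 3 * N ^ 2 := by
  have hcf := H.continuous
  have hcf' := H.continuous_deriv
  have hd : ∀ ξ, HasDerivAt (fun ξ => ξ * ‖f ξ‖ ^ 2)
      (1 * ‖f ξ‖ ^ 2 + ξ * (2 * inner ℝ (f ξ) (f' ξ))) ξ := fun ξ =>
    (hasDerivAt_id' ξ).mul (H.hasDerivAt ξ).norm_sq
  have hcont : Continuous fun ξ => 1 * ‖f ξ‖ ^ 2 + ξ * (2 * inner ℝ (f ξ) (f' ξ)) := by fun_prop
  have hFTC := intervalIntegral.integral_eq_sub_of_hasDerivAt (fun ξ _ => hd ξ)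
    (hcont.intervalIntegrable 0 x)
  have hle : ∫ ξ in (0 : ℝ)..x, (1 * ‖f ξ‖ ^ 2 + ξ * (2 * inner ℝ (f ξ) (f' ξ))) ≤
      ∫ ξ in (0 : ℝ)..x, (2 * ‖f ξ‖ ^ 2 + (ξ * ‖f' ξ‖) ^ 2) := by
    refine intervalIntegral.integral_mono_on hx (hcont.intervalIntegrable _ _)
      (Continuous.intervalIntegrable (by fun_prop) _ _) fun ξ hξ => ?_
    have h1 := mul_le_mul_of_nonneg_left (real_inner_le_norm (f ξ) (f' ξ)) hξ.1
    nlinarith [sq_nonneg (‖f ξ‖ - ξ * ‖f' ξ‖)]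
  rw [hFTC, intervalIntegral.integral_add (Continuous.intervalIntegrable (by fun_prop) _ _)
    (Continuous.intervalIntegrable (by fun_prop) _ _), intervalIntegral.integral_const_mul] at hle
  have h1 := H.intervalIntegral_le le_rfl hx
  have h2 := H.intervalIntegral_mul_deriv_le le_rfl hx
  linarith

lemma sq_mul_norm_le (H : HalfLineBound f f' N) {x : ℝ} (hx : 0 ≤ x) :
    (x * ‖f x‖) ^ 2 ≤ 4 * N ^ 2 := by
  have hcf := H.continuous
  have hcf' := H.continuous_deriv
  have hd : ∀ ξ, HasDerivAt (fun ξ => ξ ^ 2 * ‖f ξ‖ ^ 2)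
      (2 * ξ * ‖f ξ‖ ^ 2 + ξ ^ 2 * (2 * inner ℝ (f ξ) (f' ξ))) ξ := fun ξ => by
    refine ((hasDerivAt_pow 2 ξ).mul (H.hasDerivAt ξ).norm_sq).congr_deriv ?_
    simp
  have hcont : Continuous fun ξ => 2 * ξ * ‖f ξ‖ ^ 2 + ξ ^ 2 * (2 * inner ℝ (f ξ) (f' ξ)) := by
    fun_prop
  have hFTC := intervalIntegral.integral_eq_sub_of_hasDerivAt (fun ξ _ => hd ξ)
    (hcont.intervalIntegrable 0 x)
  have hle : ∫ ξ in (0 : ℝ)..x, (2 * ξ * ‖f ξ‖ ^ 2 + ξ ^ 2 * (2 * inner ℝ (f ξ) (f' ξ))) ≤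
      ∫ ξ in (0 : ℝ)..x, (‖f ξ‖ ^ 2 + 2 * (ξ * ‖f ξ‖) ^ 2 + (ξ * ‖f' ξ‖) ^ 2) := by
    refine intervalIntegral.integral_mono_on hx (hcont.intervalIntegrable _ _)
      (Continuous.intervalIntegrable (by fun_prop) _ _) fun ξ hξ => ?_
    have h1 := mul_le_mul_of_nonneg_left (real_inner_le_norm (f ξ) (f' ξ)) (sq_nonneg ξ)
    nlinarith [sq_nonneg (ξ * ‖f ξ‖ - ξ * ‖f' ξ‖), sq_nonneg (‖f ξ‖ - ξ * ‖f ξ‖)]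
  rw [hFTC, intervalIntegral.integral_add (Continuous.intervalIntegrable (by fun_prop) _ _)
    (Continuous.intervalIntegrable (by fun_prop) _ _),
    intervalIntegral.integral_add (Continuous.intervalIntegrable (by fun_prop) _ _)
    (Continuous.intervalIntegrable (by fun_prop) _ _), intervalIntegral.integral_const_mul] at hle
  have h1 := H.intervalIntegral_le le_rfl hx
  have h2 := H.intervalIntegral_mul_deriv_le le_rfl hx
  have h3 := H.intervalIntegral_mul_le le_rfl hx
  have h4 : (x * ‖f x‖) ^ 2 = x ^ 2 * ‖f x‖ ^ 2 := by ring
  linarith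

lemma hasDerivAt_comp_sq (H : HalfLineBound f f' N) (a : ℝ) :
    HasDerivAt (fun a : ℝ => ((2 * a : ℝ) : ℂ) * f (a ^ 2))
      (2 * f (a ^ 2) + ((4 * a ^ 2 : ℝ) : ℂ) * f' (a ^ 2)) a := by
  have h1 : HasDerivAt (fun a : ℝ => ((2 * a : ℝ) : ℂ)) ((2 * 1 : ℝ) : ℂ) a :=
    ((hasDerivAt_id' a).const_mul 2).ofReal_comp
  have h2 : HasDerivAt (fun a : ℝ => f (a ^ 2)) (((2 : ℕ) * a ^ (2 - 1) : ℝ) • f' (a ^ 2)) a :=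
    (H.hasDerivAt (a ^ 2)).scomp a (hasDerivAt_pow 2 a)
  refine (h1.mul h2).congr_deriv ?_
  rw [Complex.real_smul]
  push_cast
  ring

lemma norm_comp_sq_le (H : HalfLineBound f f' N) (hN : 0 ≤ N) {a : ℝ} (ha : 0 ≤ a) :
    ‖((2 * a : ℝ) : ℂ) * f (a ^ 2)‖ ≤ 5 * N := by
  rw [norm_mul, norm_real, Real.norm_of_nonneg (by positivity)]
  refine abs_le_of_sq_le_sq' ?_ (by positivity) |>.2
  nlinarith [H.mul_norm_sq_le (sq_nonneg a), sq_nonneg N]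

lemma mul_norm_comp_sq_le (H : HalfLineBound f f' N) (hN : 0 ≤ N) {a : ℝ} (ha : 0 ≤ a) :
    a * ‖((2 * a : ℝ) : ℂ) * f (a ^ 2)‖ ≤ 5 * N := by
  rw [norm_mul, norm_real, Real.norm_of_nonneg (by positivity)]
  refine abs_le_of_sq_le_sq' ?_ (by positivity) |>.2
  nlinarith [H.sq_mul_norm_le (sq_nonneg a), sq_nonneg N]

lemma integral_norm_deriv_comp_sq_le (H : HalfLineBound f f' N) (hN : 0 < N) {x y : ℝ}
    (hx : 0 < x) (hxy : x ≤ y) :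
    ∫ a in x..y, ‖2 * f (a ^ 2) + ((4 * a ^ 2 : ℝ) : ℂ) * f' (a ^ 2)‖ ≤ 5 * N * √(y / x) := by
  have hcf := H.continuous
  have hcf' := H.continuous_deriv
  have hy : 0 < y := hx.trans_le hxy
  set ρ := √(y / x) with hρ
  have hρ0 : 0 < ρ := Real.sqrt_pos.2 (by positivity)
  have hρ2 : ρ ^ 2 = y / x := Real.sq_sqrt (by positivity)
  set g : ℝ → ℝ := fun ξ => 4 * ‖f ξ‖ ^ 2 + 16 * (ξ * ‖f' ξ‖) ^ 2 with hg
  have hgcont : Continuous g := by rw [hg]; fun_prop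
  have hinv : IntervalIntegrable (fun a : ℝ => a⁻¹) volume x y := by
    refine intervalIntegral.intervalIntegrable_inv (fun a ha => ?_) continuousOn_id
    rw [Set.uIcc_of_le hxy] at ha
    exact (hx.trans_le ha.1).ne'
  have hsub : ∫ a in x..y, g (a ^ 2) * (2 * a) = ∫ ξ in x ^ 2..y ^ 2, g ξ := by
    refine intervalIntegral.integral_comp_mul_deriv (f := fun a => a ^ 2) (fun a _ => ?_)
      (by fun_prop) hgcont
    simpa using hasDerivAt_pow 2 a
  have hgint : ∫ ξ in x ^ 2..y ^ 2, g ξ ≤ 20 * N ^ 2 := by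
    have hle : x ^ 2 ≤ y ^ 2 := by gcongr
    simp only [hg]
    rw [intervalIntegral.integral_add (Continuous.intervalIntegrable (by fun_prop) _ _)
      (Continuous.intervalIntegrable (by fun_prop) _ _), intervalIntegral.integral_const_mul,
      intervalIntegral.integral_const_mul]
    have h1 := H.intervalIntegral_le (sq_nonneg x) hle
    have h2 := H.intervalIntegral_mul_deriv_le (sq_nonneg x) hle
    linarith
  have hmono : ∫ a in x..y, ‖2 * f (a ^ 2) + ((4 * a ^ 2 : ℝ) : ℂ) * f' (a ^ 2)‖ ≤
      ∫ a in x..y, (ρ / (8 * N) * (g (a ^ 2) * (2 * a)) + 2 * N / ρ * a⁻¹) := by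
    refine intervalIntegral.integral_mono_on hxy (Continuous.intervalIntegrable (by fun_prop) _ _)
      (((Continuous.intervalIntegrable (by fun_prop) _ _).const_mul _).add (hinv.const_mul _))
      fun a ha => ?_
    have ha0 : 0 < a := hx.trans_le ha.1
    set u := ‖f (a ^ 2)‖
    set v := ‖f' (a ^ 2)‖
    have hnorm : ‖2 * f (a ^ 2) + ((4 * a ^ 2 : ℝ) : ℂ) * f' (a ^ 2)‖ ≤ 2 * u + 4 * a ^ 2 * v := by
      refine (norm_add_le _ _).trans (le_of_eq ?_)
      rw [norm_mul, norm_mul, norm_real, Real.norm_of_nonneg (by positivity)]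
      norm_num
      rfl
    refine hnorm.trans ?_
    set s := 2 * u + 4 * a ^ 2 * v with hs
    have hs2 : s ^ 2 * a ≤ g (a ^ 2) * (2 * a) := by
      have : s ^ 2 ≤ g (a ^ 2) * 2 := by
        simp only [hg, hs]
        nlinarith [sq_nonneg (2 * u - 4 * a ^ 2 * v)]
      nlinarith
    have hamgm : s ≤ ρ / (8 * N) * (s ^ 2 * a) + 2 * N / ρ * a⁻¹ := by
      have : ρ / (8 * N) * (s ^ 2 * a) + 2 * N / ρ * a⁻¹ - s =
          (ρ * s * a - 4 * N) ^ 2 / (8 * N * ρ * a) := by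
        field_simp
        ring
      have h0 : 0 ≤ (ρ * s * a - 4 * N) ^ 2 / (8 * N * ρ * a) := by positivity
      linarith
    refine hamgm.trans ?_
    gcongr
  rw [intervalIntegral.integral_add ((Continuous.intervalIntegrable (by fun_prop) _ _).const_mul _)
    (hinv.const_mul _), intervalIntegral.integral_const_mul, intervalIntegral.integral_const_mul,
    integral_inv_of_pos hx hy, hsub] at hmono
  have hlog : Real.log (y / x) ≤ ρ ^ 2 := by
    rw [hρ2]
    exact Real.log_le_self (by positivity)
  have h1 : ρ / (8 * N) * ∫ ξ in x ^ 2..y ^ 2, g ξ ≤ ρ / (8 * N) * (20 * N ^ 2) := by gcongr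
  have h2 : 2 * N / ρ * Real.log (y / x) ≤ 2 * N / ρ * ρ ^ 2 := by gcongr
  have h3 : ρ / (8 * N) * (20 * N ^ 2) + 2 * N / ρ * ρ ^ 2 = 9 / 2 * (N * ρ) := by
    field_simp
    ring
  have h4 : 0 < N * ρ := by positivity
  linarith

lemma integral_norm_Ioi_le (H : HalfLineBound f f' N) (hN : 0 < N)
    (hi : IntegrableOn f (Set.Ioi 0)) {T : ℝ} (hT : 0 < T) :
    ∫ ξ in Set.Ioi (T ^ 2), ‖f ξ‖ ≤ N / T := by
  have hsub : Set.Ioi (T ^ 2) ⊆ Set.Ioi 0 := Set.Ioi_subset_Ioi (by positivity)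
  have hpi : IntegrableOn (fun ξ : ℝ => ξ ^ (-2 : ℝ)) (Set.Ioi (T ^ 2)) :=
    integrableOn_Ioi_rpow_of_lt (by norm_num) (by positivity)
  have hmono : ∫ ξ in Set.Ioi (T ^ 2), ‖f ξ‖ ≤
      ∫ ξ in Set.Ioi (T ^ 2), (1 / (2 * N * T) * (ξ * ‖f ξ‖) ^ 2 + N * T / 2 * ξ ^ (-2 : ℝ)) := by
    refine setIntegral_mono_on (hi.mono_set hsub).norm
      (((H.integrable_mul.mono_set hsub).const_mul _).add (hpi.const_mul _)) measurableSet_Ioi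
      fun ξ hξ => ?_
    have hξ0 : 0 < ξ := hsub hξ
    have hpow : ξ ^ (-2 : ℝ) = (ξ ^ 2)⁻¹ := by
      rw [Real.rpow_neg hξ0.le]
      norm_cast
    rw [hpow]
    have : 1 / (2 * N * T) * (ξ * ‖f ξ‖) ^ 2 + N * T / 2 * (ξ ^ 2)⁻¹ - ‖f ξ‖ =
        (ξ ^ 2 * ‖f ξ‖ - N * T) ^ 2 / (2 * N * T * ξ ^ 2) := by
      field_simp
      ring
    have h0 : 0 ≤ (ξ ^ 2 * ‖f ξ‖ - N * T) ^ 2 / (2 * N * T * ξ ^ 2) := by positivity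
    linarith
  rw [integral_add ((H.integrable_mul.mono_set hsub).const_mul _) (hpi.const_mul _),
    integral_const_mul, integral_const_mul, integral_Ioi_rpow_of_lt (by norm_num) (by positivity)]
    at hmono
  have h1 : ∫ ξ in Set.Ioi (T ^ 2), (ξ * ‖f ξ‖) ^ 2 ≤ N ^ 2 :=
    (setIntegral_mono_set H.integrable_mul (Filter.Eventually.of_forall fun _ => by positivity)
      (LE.le.eventuallyLE hsub)).trans H.integral_mul_le
  have h2 : 1 / (2 * N * T) * ∫ ξ in Set.Ioi (T ^ 2), (ξ * ‖f ξ‖) ^ 2 ≤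
      1 / (2 * N * T) * N ^ 2 := by gcongr
  have h3 : (T ^ 2) ^ ((-2 : ℝ) + 1) = (T ^ 2)⁻¹ := by
    rw [show (-2 : ℝ) + 1 = -1 by norm_num, Real.rpow_neg_one]
  rw [h3] at hmono
  have h4 : 1 / (2 * N * T) * N ^ 2 + N * T / 2 * (-(T ^ 2)⁻¹ / (-2 + 1)) = N / T := by
    norm_num
    field_simp
    ring
  linarith

/-- Uniform `|A|^{-1/2}` decay on the positive half-line for the phase `A √ξ + B ξ`. -/
lemma norm_integral_Ioi_le (H : HalfLineBound f f' N) (hN : 0 < N)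
    (hi : IntegrableOn f (Set.Ioi 0)) (A B : ℝ) :
    ‖∫ ξ in Set.Ioi (0 : ℝ), cexp (I * ((A * √ξ + B * ξ : ℝ) : ℂ)) * f ξ‖ ≤
      211 * N / √(max 1 |A|) := by
  have hcf := H.continuous
  have hcf' := H.continuous_deriv
  set T := √(max 1 |A|) with hTdef
  have hT : 1 ≤ T := by
    rw [hTdef, Real.one_le_sqrt]
    exact le_max_left _ _
  have hT2 : T ^ 2 = max 1 |A| := Real.sq_sqrt (by positivity)
  have hT0 : 0 < T := by linarith
  set E : ℝ → ℂ := fun ξ => cexp (I * ((A * √ξ + B * ξ : ℝ) : ℂ)) with hE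
  have hEcont : Continuous E := by rw [hE]; fun_prop
  have hEnorm : ∀ ξ, ‖E ξ‖ = 1 := fun ξ => by
    simp only [hE]; rw [mul_comm]; exact Complex.norm_exp_ofReal_mul_I _
  have hEi : IntegrableOn (fun ξ => E ξ * f ξ) (Set.Ioi 0) := by
    refine hi.norm.mono' (hEcont.mul hcf).aestronglyMeasurable ?_
    exact Filter.Eventually.of_forall fun ξ => by rw [norm_mul, hEnorm, one_mul]
  set h : ℝ → ℂ := fun a => ((2 * a : ℝ) : ℂ) * f (a ^ 2) with hh
  have hhcont : Continuous h := by rw [hh]; fun_prop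
  have hsplit : ∫ ξ in Set.Ioi (0 : ℝ), E ξ * f ξ =
      (∫ ξ in (0 : ℝ)..T ^ 2, E ξ * f ξ) + ∫ ξ in Set.Ioi (T ^ 2), E ξ * f ξ := by
    rw [intervalIntegral.integral_of_le (by positivity), ← setIntegral_union
      (Set.Ioc_disjoint_Ioi le_rfl) measurableSet_Ioi (hEi.mono_set Set.Ioc_subset_Ioi_self)
      (hEi.mono_set (Set.Ioi_subset_Ioi (by positivity))), Set.Ioc_union_Ioi_eq_Ioi (by positivity)]
  have hsub : ∫ ξ in (0 : ℝ)..T ^ 2, E ξ * f ξ = ∫ a in (0 : ℝ)..T, E (a ^ 2) * h a := by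
    have := intervalIntegral.integral_deriv_smul_comp (a := 0) (b := T) (f := fun a : ℝ => a ^ 2)
      (f' := fun a => 2 * a) (g := fun ξ => E ξ * f ξ)
      (fun a _ => by simpa using hasDerivAt_pow 2 a) (by fun_prop) (by fun_prop)
    simp only [ne_eq, OfNat.ofNat_ne_zero, not_false_eq_true, zero_pow] at this
    rw [← this]
    refine intervalIntegral.integral_congr fun a _ => ?_
    simp only [hh, Function.comp, Complex.real_smul]
    ring
  have htail : ‖∫ ξ in Set.Ioi (T ^ 2), E ξ * f ξ‖ ≤ N / T := by
    refine (norm_integral_le_integral_norm _).trans ?_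
    simp only [norm_mul, hEnorm, one_mul]
    exact H.integral_norm_Ioi_le hN hi hT0
  have hlowfreq : ∀ y, 0 ≤ y → ‖∫ a in (0 : ℝ)..y, E (a ^ 2) * h a‖ ≤ 5 * N * y := fun y hy => by
    have := intervalIntegral.norm_integral_le_of_norm_le_const (a := 0) (b := y)
      (f := fun a => E (a ^ 2) * h a) (C := 5 * N) fun a ha => by
        rw [Set.uIoc_of_le hy] at ha
        rw [norm_mul, hEnorm, one_mul]
        exact H.norm_comp_sq_le hN.le ha.1.le
    rwa [sub_zero, abs_of_nonneg hy] at this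
  have hNT : 0 < N / T := by positivity
  rw [hsplit, hsub, mul_div_assoc]
  refine (norm_add_le _ _).trans ?_
  rcases le_or_gt |A| 1 with hA | hA
  · have hT1 : T = 1 := by rw [hTdef, max_eq_left hA, Real.sqrt_one]
    have := hlowfreq T hT0.le
    rw [hT1] at this htail hNT ⊢
    linarith
  · have hA2 : |A| = T ^ 2 := by rw [hT2, max_eq_right hA.le]
    have hA0 : A ≠ 0 := fun h0 => by norm_num [h0] at hA
    have hTi : 0 < T⁻¹ := by positivity
    have hci : ∀ u v, IntervalIntegrable (fun a => E (a ^ 2) * h a) volume u v := fun u v =>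
      Continuous.intervalIntegrable (by fun_prop) u v
    rw [← intervalIntegral.integral_add_adjacent_intervals (hci 0 T⁻¹) (hci T⁻¹ T)]
    have hmid := norm_integral_quadratic_phase_decay (β := -2 * B / A) H.hasDerivAt_comp_sq
      (by fun_prop) hT hA2 (by positivity : 0 ≤ 5 * N)
      (fun a ha => H.norm_comp_sq_le hN.le ha.le) (fun a ha => H.mul_norm_comp_sq_le hN.le ha.le)
      (fun x y hx hxy => H.integral_norm_deriv_comp_sq_le hN hx hxy)
    have hcongr : ∫ a in T⁻¹..T, E (a ^ 2) * h a = ∫ a in T⁻¹..T,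
        cexp (I * ((A * (a - -2 * B / A * a ^ 2 / 2) : ℝ) : ℂ)) *
          (((2 * a : ℝ) : ℂ) * f (a ^ 2)) := by
      refine intervalIntegral.integral_congr fun a ha => ?_
      rw [Set.uIcc_of_le ((inv_le_one_of_one_le₀ hT).trans hT)] at ha
      simp only [hE, hh]
      rw [Real.sqrt_sq (hTi.le.trans ha.1)]
      congr 4
      field_simp
      ring
    rw [← hcongr] at hmid
    have hlow := hlowfreq T⁻¹ hTi.le
    have h1 : 5 * N * T⁻¹ = 5 * (N / T) := by rw [div_eq_mul_inv]; ring
    have h2 : 41 * (5 * N) / T = 205 * (N / T) := by ring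
    rw [h1] at hlow
    rw [h2] at hmid
    have := norm_add_le (∫ a in (0 : ℝ)..T⁻¹, E (a ^ 2) * h a) (∫ a in T⁻¹..T, E (a ^ 2) * h a)
    linarith

end HalfLineBound

lemma HalfLineBound.of_integrable {f f' : ℝ → ℂ} {N : ℝ} (hd : ∀ ξ, HasDerivAt f (f' ξ) ξ)
    (hc : Continuous f') (hi₀ : Integrable fun ξ => ‖f ξ‖ ^ 2) (h₀ : ∫ ξ, ‖f ξ‖ ^ 2 ≤ N ^ 2)
    (hi₁ : Integrable fun ξ => (ξ * ‖f ξ‖) ^ 2) (h₁ : ∫ ξ, (ξ * ‖f ξ‖) ^ 2 ≤ N ^ 2)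
    (hi₂ : Integrable fun ξ => (ξ * ‖f' ξ‖) ^ 2) (h₂ : ∫ ξ, (ξ * ‖f' ξ‖) ^ 2 ≤ N ^ 2) :
    HalfLineBound f f' N where
  hasDerivAt := hd
  continuous_deriv := hc
  integrable := hi₀.integrableOn
  integral_le := (setIntegral_le_integral hi₀
    (Filter.Eventually.of_forall fun _ => by positivity)).trans h₀
  integrable_mul := hi₁.integrableOn
  integral_mul_le := (setIntegral_le_integral hi₁
    (Filter.Eventually.of_forall fun _ => by positivity)).trans h₁
  integrable_mul_deriv := hi₂.integrableOn
  integral_mul_deriv_le := (setIntegral_le_integral hi₂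
    (Filter.Eventually.of_forall fun _ => by positivity)).trans h₂

lemma HalfLineBound.of_integrable_comp_neg {f f' : ℝ → ℂ} {N : ℝ}
    (hd : ∀ ξ, HasDerivAt f (f' ξ) ξ)
    (hc : Continuous f') (hi₀ : Integrable fun ξ => ‖f ξ‖ ^ 2) (h₀ : ∫ ξ, ‖f ξ‖ ^ 2 ≤ N ^ 2)
    (hi₁ : Integrable fun ξ => (ξ * ‖f ξ‖) ^ 2) (h₁ : ∫ ξ, (ξ * ‖f ξ‖) ^ 2 ≤ N ^ 2)
    (hi₂ : Integrable fun ξ => (ξ * ‖f' ξ‖) ^ 2) (h₂ : ∫ ξ, (ξ * ‖f' ξ‖) ^ 2 ≤ N ^ 2) :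
    HalfLineBound (fun ξ => f (-ξ)) (fun ξ => -f' (-ξ)) N := by
  have hneg : ∀ g : ℝ → ℂ, (fun ξ : ℝ => (ξ * ‖g (-ξ)‖) ^ 2) =
      fun ξ => (-ξ * ‖g (-ξ)‖) ^ 2 := fun g => by
    ext ξ
    ring
  refine .of_integrable (fun ξ => ?_) (by fun_prop) hi₀.comp_neg
    ((integral_neg_eq_self (fun ξ => ‖f ξ‖ ^ 2) volume).trans_le h₀) ?_ ?_ ?_ ?_
  · exact ((hd (-ξ)).scomp ξ (hasDerivAt_neg ξ)).congr_deriv (by simp)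
  · rw [hneg]; exact hi₁.comp_neg
  · rw [hneg]; exact (integral_neg_eq_self (fun ξ => (ξ * ‖f ξ‖) ^ 2) volume).trans_le h₁
  · simp only [norm_neg]; rw [hneg]; exact hi₂.comp_neg
  · simp only [norm_neg]; rw [hneg]
    exact (integral_neg_eq_self (fun ξ => (ξ * ‖f' ξ‖) ^ 2) volume).trans_le h₂

namespace SchwartzMap

lemma integrable_norm_sq (ψ : SchwartzMap ℝ ℂ) : Integrable fun x => ‖ψ x‖ ^ 2 :=
  (ψ.memLp 2 volume).integrable_norm_pow (by norm_num)

lemma integral_norm_sq_eq (ψ : SchwartzMap ℝ ℂ) :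
    ∫ x, ‖ψ x‖ ^ 2 = (eLpNorm ψ 2 volume).toReal ^ 2 := by
  have h0 : 0 ≤ ∫ x, ‖ψ x‖ ^ 2 := integral_nonneg fun _ => by positivity
  rw [(ψ.memLp 2 volume).eLpNorm_eq_integral_rpow_norm (by norm_num) (by norm_num)]
  simp only [ENNReal.toReal_ofNat, Real.rpow_ofNat]
  rw [ENNReal.toReal_ofReal (by positivity), ← Real.rpow_natCast, ← Real.rpow_mul h0]
  norm_num

/-- Multiplication by the coordinate function on one-dimensional Schwartz functions. -/
noncomputable def mulCoord (ψ : SchwartzMap ℝ ℂ) : SchwartzMap ℝ ℂ :=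
  smulLeftCLM ℂ (fun x : ℝ => (x : ℂ)) ψ

lemma mulCoord_apply (ψ : SchwartzMap ℝ ℂ) (x : ℝ) : mulCoord ψ x = x * ψ x := by
  have : (fun x : ℝ => (x : ℂ)).HasTemperateGrowth :=
    Complex.ofRealCLM.hasTemperateGrowth
  rw [mulCoord, smulLeftCLM_apply_apply this, smul_eq_mul]

lemma fourier_deriv_apply (φ : SchwartzMap ℝ ℂ) (ξ : ℝ) :
    𝓕 (derivCLM ℂ ℂ φ) ξ = 2 * π * I * ξ * 𝓕 φ ξ := by
  have h := Real.fourier_deriv φ.integrable φ.differentiable (derivCLM ℂ ℂ φ).integrable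
  exact congrFun h ξ

lemma hasDerivAt_fourier_mulCoord (φ : SchwartzMap ℝ ℂ) (ξ : ℝ) :
    HasDerivAt (fun ξ => 𝓕 φ ξ) (-2 * π * I * 𝓕 (mulCoord φ) ξ) ξ := by
  have hi : Integrable fun x : ℝ => x • φ x := by
    refine (mulCoord φ).integrable.congr (Filter.Eventually.of_forall fun x => ?_)
    simp only [mulCoord_apply, Complex.real_smul]
  refine (Real.hasDerivAt_fourier φ.integrable hi ξ).congr_deriv ?_
  rw [fourier_coe, Real.fourier_eq, Real.fourier_eq, ← integral_const_mul]
  refine integral_congr_ae (Filter.Eventually.of_forall fun x => ?_)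
  simp only [mulCoord_apply, Circle.smul_def, smul_eq_mul]
  ring

lemma mul_deriv_fourier_s6 (φ : SchwartzMap ℝ ℂ) (ξ : ℝ) :
    ξ * (-2 * π * I * 𝓕 (mulCoord φ) ξ) =
      -(𝓕 φ ξ + 𝓕 (mulCoord (derivCLM ℂ ℂ φ)) ξ) := by
  have h1 := hasDerivAt_fourier_mulCoord (derivCLM ℂ ℂ φ) ξ
  have h2 : HasDerivAt (fun ξ : ℝ => 2 * π * I * ξ * 𝓕 φ ξ)
      (2 * π * I * 1 * 𝓕 φ ξ + 2 * π * I * ξ * (-2 * π * I * 𝓕 (mulCoord φ) ξ)) ξ :=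
    ((Complex.ofRealCLM.hasDerivAt.const_mul (2 * π * I : ℂ))).mul (hasDerivAt_fourier_mulCoord φ ξ)
  have h3 : (fun ξ : ℝ => 2 * π * I * ξ * 𝓕 φ ξ) = fun ξ => 𝓕 (derivCLM ℂ ℂ φ) ξ :=
    funext fun ξ => (fourier_deriv_apply φ ξ).symm
  rw [h3] at h2
  have h4 := h1.unique h2
  have h5 : (2 * π * I : ℂ) ≠ 0 := by
    simp [Real.pi_ne_zero]
  apply mul_left_cancel₀ h5
  linear_combination -h4

/-- The norm `‖φ‖_{L²} + ‖φ'‖_{L²} + ‖x φ'‖_{L²}`. -/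
noncomputable def decayNorm (φ : SchwartzMap ℝ ℂ) : ℝ :=
  (eLpNorm φ 2 volume).toReal + (eLpNorm (deriv φ) 2 volume).toReal +
    (eLpNorm (fun x : ℝ => (x : ℂ) * deriv φ x) 2 volume).toReal

lemma fourier_halfLineBound (φ : SchwartzMap ℝ ℂ) {N : ℝ} (hN : 2 * decayNorm φ ≤ N) :
    HalfLineBound (fun ξ => 𝓕 φ ξ) (fun ξ => -2 * π * I * 𝓕 (mulCoord φ) ξ) N ∧
      HalfLineBound (fun ξ => 𝓕 φ (-ξ)) (fun ξ => -(-2 * π * I * 𝓕 (mulCoord φ) (-ξ))) N := by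
  set ψ₁ := derivCLM ℂ ℂ φ with hψ₁
  set ψ₂ := mulCoord ψ₁ with hψ₂
  set N₀ := (eLpNorm φ 2 volume).toReal with hN₀
  set N₁ := (eLpNorm (deriv φ) 2 volume).toReal with hN₁
  set N₂ := (eLpNorm (fun x : ℝ => (x : ℂ) * deriv φ x) 2 volume).toReal with hN₂
  have p₀ : 0 ≤ N₀ := ENNReal.toReal_nonneg
  have p₁ : 0 ≤ N₁ := ENNReal.toReal_nonneg
  have p₂ : 0 ≤ N₂ := ENNReal.toReal_nonneg
  have hN' : 2 * (N₀ + N₁ + N₂) ≤ N := hN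
  have i₀ : ∫ ξ, ‖𝓕 φ ξ‖ ^ 2 = N₀ ^ 2 := by
    rw [integral_norm_sq_fourier, integral_norm_sq_eq]
  have i₁ : ∫ ξ, ‖𝓕 ψ₁ ξ‖ ^ 2 = N₁ ^ 2 := by
    rw [integral_norm_sq_fourier, integral_norm_sq_eq]
    rfl
  have i₂ : ∫ ξ, ‖𝓕 ψ₂ ξ‖ ^ 2 = N₂ ^ 2 := by
    rw [integral_norm_sq_fourier, integral_norm_sq_eq]
    congr 3
    ext x
    rw [hψ₂, mulCoord_apply, hψ₁, derivCLM_apply]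
  have hd := hasDerivAt_fourier_mulCoord φ
  have hc : Continuous fun ξ => -2 * π * I * 𝓕 (mulCoord φ) ξ :=
    (𝓕 (mulCoord φ)).continuous.const_mul _
  have hle₁ : ∀ ξ : ℝ, (ξ * ‖𝓕 φ ξ‖) ^ 2 ≤ ‖𝓕 ψ₁ ξ‖ ^ 2 := fun ξ => by
    rw [hψ₁, fourier_deriv_apply]
    simp only [norm_mul, Complex.norm_ofNat, norm_real, norm_I, mul_one, Real.norm_eq_abs,
      mul_pow, sq_abs]
    have h1 : 1 ≤ 2 ^ 2 * π ^ 2 := by nlinarith [Real.pi_gt_three]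
    have h2 : 0 ≤ ξ ^ 2 * ‖𝓕 φ ξ‖ ^ 2 := by positivity
    nlinarith
  have hle₂ : ∀ ξ : ℝ, (ξ * ‖-2 * π * I * 𝓕 (mulCoord φ) ξ‖) ^ 2 ≤
      2 * ‖𝓕 φ ξ‖ ^ 2 + 2 * ‖𝓕 ψ₂ ξ‖ ^ 2 := fun ξ => by
    have h1 : (ξ * ‖-2 * π * I * 𝓕 (mulCoord φ) ξ‖) ^ 2 = ‖𝓕 φ ξ + 𝓕 ψ₂ ξ‖ ^ 2 := by
      rw [hψ₂, hψ₁, ← norm_neg (𝓕 φ ξ + _), ← mul_deriv_fourier_s6, norm_mul (ξ : ℂ), norm_real,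
        Real.norm_eq_abs, mul_pow, mul_pow, sq_abs]
    rw [h1]
    have h2 := pow_le_pow_left₀ (norm_nonneg _) (norm_add_le (𝓕 φ ξ) (𝓕 ψ₂ ξ)) 2
    nlinarith [sq_nonneg (‖𝓕 φ ξ‖ - ‖𝓕 ψ₂ ξ‖)]
  have hcφ : Continuous (fun ξ => 𝓕 φ ξ) := (𝓕 φ).continuous
  have hi₀ := (𝓕 φ).integrable_norm_sq
  have hib : Integrable fun ξ => 2 * ‖𝓕 φ ξ‖ ^ 2 + 2 * ‖𝓕 ψ₂ ξ‖ ^ 2 :=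
    (hi₀.const_mul 2).add ((𝓕 ψ₂).integrable_norm_sq.const_mul 2)
  have hi₁ : Integrable fun ξ => (ξ * ‖𝓕 φ ξ‖) ^ 2 := by
    refine (𝓕 ψ₁).integrable_norm_sq.mono' (Continuous.aestronglyMeasurable (by fun_prop))
      (Filter.Eventually.of_forall fun ξ => ?_)
    rw [Real.norm_of_nonneg (by positivity)]
    exact hle₁ ξ
  have hi₂ : Integrable fun ξ => (ξ * ‖-2 * π * I * 𝓕 (mulCoord φ) ξ‖) ^ 2 := by
    refine hib.mono' (Continuous.aestronglyMeasurable (by fun_prop))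
      (Filter.Eventually.of_forall fun ξ => ?_)
    rw [Real.norm_of_nonneg (by positivity)]
    exact hle₂ ξ
  have h₀ : ∫ ξ, ‖𝓕 φ ξ‖ ^ 2 ≤ N ^ 2 := by
    rw [i₀]
    exact pow_le_pow_left₀ p₀ (by linarith) 2
  have h₁ : ∫ ξ, (ξ * ‖𝓕 φ ξ‖) ^ 2 ≤ N ^ 2 := by
    refine (integral_mono hi₁ (𝓕 ψ₁).integrable_norm_sq hle₁).trans ?_
    rw [i₁]
    exact pow_le_pow_left₀ p₁ (by linarith) 2
  have h₂ : ∫ ξ, (ξ * ‖-2 * π * I * 𝓕 (mulCoord φ) ξ‖) ^ 2 ≤ N ^ 2 := by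
    refine (integral_mono hi₂ hib hle₂).trans ?_
    rw [integral_add (hi₀.const_mul 2) ((𝓕 ψ₂).integrable_norm_sq.const_mul 2),
      integral_const_mul, integral_const_mul, i₀, i₂]
    have := pow_le_pow_left₀ (by positivity) hN' 2
    nlinarith [mul_nonneg p₀ p₁, mul_nonneg p₀ p₂, mul_nonneg p₁ p₂]
  exact ⟨.of_integrable hd hc hi₀ h₀ hi₁ h₁ hi₂ h₂,
    .of_integrable_comp_neg hd hc hi₀ h₀ hi₁ h₁ hi₂ h₂⟩

lemma norm_halfWave_le (φ : SchwartzMap ℝ ℂ) (t x : ℝ) :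
    ‖𝓕⁻ (fun ξ : ℝ => cexp (I * t * (|ξ| ^ ((1 : ℝ) / 2) : ℝ)) * 𝓕 (⇑φ) ξ) x‖ ≤
      844 * decayNorm φ / √(max 1 |t|) := by
  set T := √(max 1 |t|) with hT
  have hT1 : 1 ≤ T := by
    rw [hT, Real.one_le_sqrt]
    exact le_max_left _ _
  have hT0 : 0 < T := by linarith
  have hS : 0 ≤ decayNorm φ := by unfold decayNorm; positivity
  refine le_of_forall_pos_le_add fun ε hε => ?_
  set N := 2 * decayNorm φ + ε / 422 with hNdef
  have hN : 0 < N := by positivity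
  obtain ⟨H₁, H₂⟩ := fourier_halfLineBound φ (N := N)
    (by rw [hNdef]; linarith [div_pos hε (by norm_num : (0 : ℝ) < 422)])
  have hfi : Integrable (fun ξ => 𝓕 φ ξ) := (𝓕 φ).integrable
  have b₁ := H₁.norm_integral_Ioi_le hN hfi.integrableOn t (2 * π * x)
  have b₂ := H₂.norm_integral_Ioi_le hN hfi.comp_neg.integrableOn t (-(2 * π * x))
  set F : ℝ → ℂ := fun ξ => cexp (I * ((t * √|ξ| + 2 * π * x * ξ : ℝ) : ℂ)) * 𝓕 φ ξ with hF
  have hFi : Integrable F := by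
    have hcφ : Continuous (fun ξ => 𝓕 φ ξ) := (𝓕 φ).continuous
    refine hfi.norm.mono' (Continuous.aestronglyMeasurable (by rw [hF]; fun_prop)) ?_
    refine Filter.Eventually.of_forall fun ξ => ?_
    simp only [hF]
    rw [norm_mul, mul_comm I, Complex.norm_exp_ofReal_mul_I, one_mul]
  have hinv : 𝓕⁻ (fun ξ : ℝ => cexp (I * t * (|ξ| ^ ((1 : ℝ) / 2) : ℝ)) * 𝓕 (⇑φ) ξ) x =
      ∫ ξ, F ξ := by
    rw [Real.fourierInv_eq']
    refine integral_congr_ae (Filter.Eventually.of_forall fun ξ => ?_)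
    simp only [hF, smul_eq_mul, fourier_coe]
    rw [← mul_assoc, ← Complex.exp_add, Real.sqrt_eq_rpow]
    congr 2
    simp only [RCLike.inner_apply, conj_trivial]
    push_cast
    ring
  have hIoi : ∫ ξ in Set.Ioi (0 : ℝ), F ξ =
      ∫ ξ in Set.Ioi (0 : ℝ), cexp (I * ((t * √ξ + 2 * π * x * ξ : ℝ) : ℂ)) * 𝓕 φ ξ := by
    refine setIntegral_congr_fun measurableSet_Ioi fun ξ hξ => ?_
    simp only [hF]
    rw [abs_of_pos hξ]
  have hIic : ∫ ξ in Set.Iic (0 : ℝ), F ξ =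
      ∫ ξ in Set.Ioi (0 : ℝ), cexp (I * ((t * √ξ + -(2 * π * x) * ξ : ℝ) : ℂ)) * 𝓕 φ (-ξ) := by
    have h := integral_comp_neg_Ioi 0 F
    rw [neg_zero] at h
    rw [← h]
    refine setIntegral_congr_fun measurableSet_Ioi fun ξ hξ => ?_
    simp only [hF]
    rw [abs_neg, abs_of_pos hξ, mul_neg, neg_mul]
  rw [hinv, ← intervalIntegral.integral_Iic_add_Ioi (b := 0) hFi.integrableOn hFi.integrableOn,
    hIoi, hIic]
  refine (norm_add_le _ _).trans ((add_le_add b₂ b₁).trans ?_)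
  have h1 : 211 * N / T + 211 * N / T = 844 * decayNorm φ / T + ε / T := by
    rw [hNdef]
    field_simp
    ring
  rw [h1]
  gcongr
  exact div_le_self hε.le hT1

end SchwartzMap

/-- Theorem 1.1: optimal decay for the half-wave equation
`iu_t − (−Δ)^{1/4}u = 0`:
`‖e^{itΦ(D)}φ‖_{L^∞} ≤ C(1+|t|)^{−1/2}(‖φ‖_{H¹} + ‖x∂_xφ‖_{L²})` with `Φ(ξ)=|ξ|^{1/2}`. -/
theorem water_wave_linear_decay :
    ∃ C > 0, ∀ (φ : SchwartzMap ℝ ℂ) (t : ℝ),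
      eLpNorm (𝓕⁻ (fun ξ : ℝ =>
          Complex.exp (Complex.I * t * (|ξ| ^ ((1 : ℝ) / 2) : ℝ)) * 𝓕 (⇑φ) ξ)) ⊤ volume ≤
        ENNReal.ofReal (C * (1 + |t|) ^ (-(1 : ℝ) / 2) *
          ((eLpNorm (⇑φ) 2 volume).toReal + (eLpNorm (deriv (⇑φ)) 2 volume).toReal +
            (eLpNorm (fun x : ℝ => (x : ℂ) * deriv (⇑φ) x) 2 volume).toReal)) := by
  refine ⟨1688, by norm_num, fun φ t => ?_⟩
  rw [eLpNorm_exponent_top]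
  refine eLpNormEssSup_le_of_ae_bound (Filter.Eventually.of_forall fun x => ?_)
  refine (φ.norm_halfWave_le t x).trans ?_
  change _ ≤ 1688 * (1 + |t|) ^ (-(1 : ℝ) / 2) * φ.decayNorm
  have hS : 0 ≤ φ.decayNorm := by unfold SchwartzMap.decayNorm; positivity
  have ht : 0 < 1 + |t| := by positivity
  have hmax : 0 < max 1 |t| := by positivity
  have hsqrt : √(1 + |t|) ≤ 2 * √(max 1 |t|) := by
    rw [Real.sqrt_le_left (by positivity), mul_pow, Real.sq_sqrt hmax.le]
    linarith [le_max_left 1 |t|, le_max_right 1 |t|]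
  have hrpow : (1 + |t|) ^ (-(1 : ℝ) / 2) = (√(1 + |t|))⁻¹ := by
    rw [neg_div, Real.rpow_neg ht.le, Real.sqrt_eq_rpow]
  have hinv : (√(max 1 |t|))⁻¹ ≤ 2 * (√(1 + |t|))⁻¹ := by
    rw [inv_le_iff_one_le_mul₀ (by positivity), mul_right_comm, ← div_eq_mul_inv,
      one_le_div (by positivity)]
    exact hsqrt
  rw [hrpow, div_eq_mul_inv]
  have := mul_le_mul_of_nonneg_left hinv hS
  linarith
end

section
/- Let Λ(t) = 2^{−10}(1+|t|) and Φ(ξ)=|ξ|^{1/2}. For all Schwartz φ, t ∈ ℝ, and x ∈ ℝ: Σ_{k∈ℤ, 2^k ≥ Λ(t)} |(P_k e^{itΦ(D)}φ)(x)| ≤ C(1+|t|)^{−1/2}‖φ‖_{H¹}, for an absolute constant C. -/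
open MeasureTheory FourierTransform Real Complex

namespace LittlewoodPaley

/-- Cauchy–Schwarz on a symmetric interval. -/
lemma setIntegral_norm_Icc_le {h : ℝ → ℂ} (hh : MemLp h 2 volume) {R : ℝ}
    (hR : 0 ≤ R) :
    ∫ ξ in Set.Icc (-R) R, ‖h ξ‖ ≤ √(2 * R) * (eLpNorm h 2 volume).toReal := by
  have hm : AEStronglyMeasurable h (volume.restrict (Set.Icc (-R) R)) :=
    hh.aestronglyMeasurable.restrict
  have hfin : eLpNorm h 2 volume ≠ ⊤ := hh.eLpNorm_ne_top
  have holder := eLpNorm_le_eLpNorm_mul_rpow_measure_univ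
    (p := 1) (q := 2) (μ := volume.restrict (Set.Icc (-R) R)) (by norm_num) hm
  have hvol : (volume.restrict (Set.Icc (-R) R)) Set.univ
      ^ (1 / (1 : ENNReal).toReal - 1 / (2 : ENNReal).toReal) = ENNReal.ofReal √(2 * R) := by
    rw [Measure.restrict_apply_univ, Real.volume_Icc, Real.sqrt_eq_rpow,
      ENNReal.ofReal_rpow_of_nonneg (by linarith) (by norm_num)]
    norm_num [two_mul]
  rw [hvol] at holder
  have hle := holder.trans
    (mul_le_mul_left (eLpNorm_mono_measure h Measure.restrict_le_self) (ENNReal.ofReal √(2 * R)))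
  rw [integral_norm_eq_lintegral_enorm hm, ← eLpNorm_one_eq_lintegral_enorm]
  refine (ENNReal.toReal_mono (ENNReal.mul_ne_top hfin ENNReal.ofReal_ne_top) hle).trans ?_
  rw [ENNReal.toReal_mul, ENNReal.toReal_ofReal (Real.sqrt_nonneg _), mul_comm]

/-- Plancherel's theorem for Schwartz functions, in terms of `eLpNorm`. -/
lemma toReal_eLpNorm_fourier (f : SchwartzMap ℝ ℂ) :
    (eLpNorm (𝓕 f : SchwartzMap ℝ ℂ) 2 volume).toReal = (eLpNorm f 2 volume).toReal := by
  have := SchwartzMap.norm_fourier_toL2_eq f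
  rwa [SchwartzMap.norm_toLp, SchwartzMap.norm_toLp] at this

/-- The Fourier transform of the derivative of a Schwartz function. -/
lemma fourier_derivCLM_apply (φ : SchwartzMap ℝ ℂ) (ξ : ℝ) :
    (𝓕 (SchwartzMap.derivCLM ℝ ℂ φ) : SchwartzMap ℝ ℂ) ξ = 2 * π * I * ξ * 𝓕 (⇑φ) ξ := by
  have hd : (SchwartzMap.derivCLM ℝ ℂ φ : ℝ → ℂ) = deriv φ := by
    ext y; simp
  have := Real.fourier_deriv φ.integrable φ.differentiable
    (hd ▸ (SchwartzMap.derivCLM ℝ ℂ φ).integrable)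
  rw [SchwartzMap.fourier_coe, hd, this]
  simp [mul_assoc]

/-- Bernstein's inequality for a frequency-localized piece: a multiplier bounded by one and
supported in `2 ^ (k - 1) ≤ |ξ| ≤ 2 ^ (k + 1)` maps `H¹` to `L^∞` with norm `O(2 ^ (-k / 2))`. -/
lemma norm_fourierInv_mul_fourier_le (m : ℝ → ℂ) (k : ℤ) (hm : ∀ ξ, ‖m ξ‖ ≤ 1)
    (hlow : ∀ ξ, |ξ| ≤ 2 ^ (k - 1) → m ξ = 0) (hhigh : ∀ ξ, 2 ^ (k + 1) ≤ |ξ| → m ξ = 0)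
    (φ : SchwartzMap ℝ ℂ) (x : ℝ) :
    ‖𝓕⁻ (fun ξ : ℝ => m ξ * 𝓕 (⇑φ) ξ) x‖ ≤
      4 * (√2)⁻¹ ^ k * (eLpNorm (deriv (⇑φ)) 2 volume).toReal := by
  set h : SchwartzMap ℝ ℂ := 𝓕 (SchwartzMap.derivCLM ℝ ℂ φ) with hh
  have hk : (0 : ℝ) < 2 ^ k := by positivity
  have hk1 : (2 : ℝ) ^ (k - 1) = 2 ^ k / 2 := by rw [zpow_sub_one₀ two_ne_zero]; ring
  have hk2 : (2 : ℝ) ^ (k + 1) = 2 ^ k * 2 := by rw [zpow_add_one₀ two_ne_zero]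
  have hpt : ∀ ξ, ‖m ξ * 𝓕 (⇑φ) ξ‖ ≤
      (Set.Icc (-(2 ^ k * 2 : ℝ)) (2 ^ k * 2)).indicator (fun ξ => 2 / 2 ^ k * ‖h ξ‖) ξ := by
    intro ξ
    by_cases hξ1 : |ξ| ≤ 2 ^ (k - 1)
    · rw [hlow ξ hξ1, zero_mul, norm_zero]
      exact Set.indicator_nonneg (fun _ _ => by positivity) _
    by_cases hξ2 : 2 ^ (k + 1) ≤ |ξ|
    · rw [hhigh ξ hξ2, zero_mul, norm_zero]
      exact Set.indicator_nonneg (fun _ _ => by positivity) _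
    rw [not_le, hk1] at hξ1
    rw [not_le, hk2] at hξ2
    rw [Set.indicator_of_mem (Set.mem_Icc.2 (abs_le.mp hξ2.le)), hh, fourier_derivCLM_apply, norm_mul, norm_mul]
    refine mul_le_of_le_one_left (norm_nonneg _) (hm ξ) |>.trans ?_
    rw [← mul_assoc]
    refine le_mul_of_one_le_left (norm_nonneg _) ?_
    have hn : ‖(2 * π * I * ξ : ℂ)‖ = 2 * π * |ξ| := by
      simp [abs_of_pos Real.pi_pos]
    rw [hn, div_mul_eq_mul_div, one_le_div hk]
    nlinarith [Real.pi_gt_three, abs_nonneg ξ]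
  have hS : MeasurableSet (Set.Icc (-(2 ^ k * 2 : ℝ)) (2 ^ k * 2)) := measurableSet_Icc
  have hint : Integrable
      ((Set.Icc (-(2 ^ k * 2 : ℝ)) (2 ^ k * 2)).indicator (fun ξ => 2 / 2 ^ k * ‖h ξ‖)) :=
    (h.integrable.norm.const_mul _).indicator hS
  have hsq : (2 : ℝ) ^ k = √2 ^ k * √2 ^ k := by
    rw [← mul_zpow, Real.mul_self_sqrt zero_le_two]
  have hs0 : (0 : ℝ) < √2 ^ k := by positivity
  have hroot : √(2 * (2 ^ k * 2)) = 2 * √2 ^ k := by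
    rw [hsq, Real.sqrt_eq_iff_mul_self_eq_of_pos (by positivity)]
    ring
  have hd : (SchwartzMap.derivCLM ℝ ℂ φ : ℝ → ℂ) = deriv φ := by
    ext y; simp
  calc ‖𝓕⁻ (fun ξ : ℝ => m ξ * 𝓕 (⇑φ) ξ) x‖
      ≤ ∫ ξ, (Set.Icc (-(2 ^ k * 2 : ℝ)) (2 ^ k * 2)).indicator
          (fun ξ => 2 / 2 ^ k * ‖h ξ‖) ξ := by
        rw [Real.fourierInv_eq]
        exact norm_integral_le_of_norm_le hint (.of_forall fun ξ => by
          rw [Circle.norm_smul]; exact hpt ξ)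
    _ = 2 / 2 ^ k * ∫ ξ in Set.Icc (-(2 ^ k * 2 : ℝ)) (2 ^ k * 2), ‖h ξ‖ := by
        rw [integral_indicator hS, integral_const_mul]
    _ ≤ 2 / 2 ^ k * (√(2 * (2 ^ k * 2)) * (eLpNorm h 2 volume).toReal) := by
        gcongr
        exact setIntegral_norm_Icc_le (h.memLp 2) (by positivity)
    _ = 4 * (√2)⁻¹ ^ k * (eLpNorm (deriv (⇑φ)) 2 volume).toReal := by
        rw [hh, toReal_eLpNorm_fourier, hd, hroot, hsq, inv_zpow]
        field_simp
        ring

/-- The dyadic geometric series over `2 ^ k ≥ L` with ratio `1 / √2` is summable, with sum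
`O(L ^ (-1 / 2))`. -/
lemma summable_and_tsum_dyadic_le {L : ℝ} (hL : 0 < L) :
    Summable (fun k : ℤ => if L ≤ 2 ^ k then (√2)⁻¹ ^ k else 0) ∧
      ∑' k : ℤ, (if L ≤ 2 ^ k then (√2)⁻¹ ^ k else 0) ≤ (1 - (√2)⁻¹)⁻¹ * L ^ (-(1 : ℝ) / 2) := by
  set K := Int.clog 2 L
  have hiff : ∀ k : ℤ, L ≤ 2 ^ k ↔ K ≤ k := fun k => by
    simpa using Int.le_zpow_iff_clog_le (b := 2) one_lt_two (x := k) hL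
  have hr1 : (√2)⁻¹ < 1 := inv_lt_one_of_one_lt₀ (by
    rw [Real.lt_sqrt zero_le_one]; norm_num)
  have hinj : Function.Injective (fun n : ℕ => K + (n : ℤ)) := fun a b hab => by
    simpa using hab
  have hsum : HasSum (fun k : ℤ => if L ≤ 2 ^ k then (√2)⁻¹ ^ k else 0)
      ((√2)⁻¹ ^ K * (1 - (√2)⁻¹)⁻¹) := by
    rw [← hinj.hasSum_iff]
    · convert! (hasSum_geometric_of_lt_one (by positivity) hr1).mul_left ((√2)⁻¹ ^ K) using 1
      ext n
      simp [hiff, zpow_add₀ (show √2 ≠ 0 by positivity), mul_comm]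
    · intro k hk
      refine if_neg fun hle => hk ⟨(k - K).toNat, ?_⟩
      have := (hiff k).1 hle
      simp only
      omega
  refine ⟨hsum.summable, hsum.tsum_eq.trans_le ?_⟩
  rw [mul_comm]
  have h1 : (0 : ℝ) ≤ (1 - (√2)⁻¹)⁻¹ := inv_nonneg.2 (by linarith)
  refine mul_le_mul_of_nonneg_left ?_ h1
  have hpow : (√2)⁻¹ ^ K = ((2 : ℝ) ^ K) ^ (-(1 : ℝ) / 2) := by
    rw [Real.sqrt_eq_rpow, ← Real.rpow_neg zero_le_two, ← Real.rpow_intCast, ← Real.rpow_intCast,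
      ← Real.rpow_mul zero_le_two, ← Real.rpow_mul zero_le_two]
    congr 1; ring
  rw [hpow]
  exact Real.rpow_le_rpow_of_nonpos hL ((hiff K).2 le_rfl) (by norm_num)

end LittlewoodPaley

/-- high-frequency estimate: the sum of `|(P_k e^{itΦ(D)}φ)(x)|` over
`2^k ≥ Λ(t) = 2^{−10}(1+|t|)` is bounded by `C(1+|t|)^{−1/2}‖φ‖_{H¹}`. -/
theorem high_frequency_sum_bound
    (ψ : ℝ → ℝ) (hψ_smooth : ContDiff ℝ (⊤ : ℕ∞) ψ) (hψ_supp : HasCompactSupport ψ)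
    (hψ_nonneg : ∀ x, 0 ≤ ψ x) (hψ_le_one : ∀ x, ψ x ≤ 1)
    (hψ_supp' : Function.support ψ ⊆ Set.Ioo (-2) 2)
    (hψ_one : ∀ x : ℝ, |x| ≤ 1 → ψ x = 1)
    (hψ_even : ∀ x : ℝ, ψ (-x) = ψ x) :
    ∃ C > 0, ∀ (φ : SchwartzMap ℝ ℂ) (t x : ℝ),
      (∑' k : ℤ, if (2 : ℝ) ^ (-10 : ℤ) * (1 + |t|) ≤ (2 : ℝ) ^ k then
          ‖𝓕⁻ (fun ξ : ℝ =>
            ((ψ (ξ / 2 ^ k) - ψ (ξ / 2 ^ (k - 1)) : ℝ) : ℂ) *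
              Complex.exp (Complex.I * t * (|ξ| ^ ((1 : ℝ) / 2) : ℝ)) * 𝓕 (⇑φ) ξ) x‖
        else 0) ≤
      C * (1 + |t|) ^ (-(1 : ℝ) / 2) *
        ((eLpNorm (⇑φ) 2 volume).toReal + (eLpNorm (deriv (⇑φ)) 2 volume).toReal) := by
  have hr1 : (√2)⁻¹ < 1 := inv_lt_one_of_one_lt₀ (by
    rw [Real.lt_sqrt zero_le_one]; norm_num)
  have hc : 0 < (1 - (√2)⁻¹)⁻¹ := inv_pos.2 (by linarith)
  refine ⟨4 * (1 - (√2)⁻¹)⁻¹ * ((2 : ℝ) ^ (-10 : ℤ)) ^ (-(1 : ℝ) / 2), by positivity,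
    fun φ t x => ?_⟩
  set A := (eLpNorm (deriv (⇑φ)) 2 volume).toReal
  have hA0 : 0 ≤ A := ENNReal.toReal_nonneg
  have hB0 : 0 ≤ (eLpNorm (⇑φ) 2 volume).toReal := ENNReal.toReal_nonneg
  set L : ℝ := (2 : ℝ) ^ (-10 : ℤ) * (1 + |t|) with hLdef
  have hL : 0 < L := by positivity
  obtain ⟨hs, hle⟩ := LittlewoodPaley.summable_and_tsum_dyadic_le hL
  have hpiece : ∀ k : ℤ, ‖𝓕⁻ (fun ξ : ℝ =>
      ((ψ (ξ / 2 ^ k) - ψ (ξ / 2 ^ (k - 1)) : ℝ) : ℂ) *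
        Complex.exp (Complex.I * t * (|ξ| ^ ((1 : ℝ) / 2) : ℝ)) * 𝓕 (⇑φ) ξ) x‖ ≤
      4 * (√2)⁻¹ ^ k * A := by
    intro k
    have hk : (0 : ℝ) < 2 ^ k := by positivity
    have hk1 : (2 : ℝ) ^ (k - 1) = 2 ^ k / 2 := by rw [zpow_sub_one₀ two_ne_zero]; ring
    have hk2 : (2 : ℝ) ^ (k + 1) = 2 ^ k * 2 := by rw [zpow_add_one₀ two_ne_zero]
    have hψ_zero : ∀ y : ℝ, 2 ≤ |y| → ψ y = 0 := fun y hy => by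
      by_contra hne
      exact absurd (abs_lt.2 (hψ_supp' hne)) (not_lt.2 hy)
    refine LittlewoodPaley.norm_fourierInv_mul_fourier_le _ k (fun ξ => ?_) (fun ξ hξ => ?_)
      (fun ξ hξ => ?_) φ x
    · have hexp : ‖Complex.exp (Complex.I * t * (|ξ| ^ ((1 : ℝ) / 2) : ℝ))‖ = 1 := by
        rw [mul_assoc, ← Complex.ofReal_mul, Complex.norm_exp_I_mul_ofReal]
      rw [norm_mul, hexp, mul_one, Complex.norm_real, Real.norm_eq_abs, abs_le]
      constructor <;> linarith [hψ_nonneg (ξ / 2 ^ k), hψ_le_one (ξ / 2 ^ k),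
        hψ_nonneg (ξ / 2 ^ (k - 1)), hψ_le_one (ξ / 2 ^ (k - 1))]
    · have hpos : (0 : ℝ) < 2 ^ (k - 1) := by positivity
      rw [hψ_one (ξ / 2 ^ k), hψ_one (ξ / 2 ^ (k - 1))]
      · simp
      · rwa [abs_div, abs_of_pos hpos, div_le_one hpos]
      · rw [abs_div, abs_of_pos hk, div_le_one hk]
        linarith
    · have hpos : (0 : ℝ) < 2 ^ (k - 1) := by positivity
      rw [hψ_zero (ξ / 2 ^ k), hψ_zero (ξ / 2 ^ (k - 1))]
      · simp
      · rw [abs_div, abs_of_pos hpos, le_div_iff₀ hpos]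
        linarith
      · rw [abs_div, abs_of_pos hk, le_div_iff₀ hk]
        linarith
  have hterm : ∀ k : ℤ, (if L ≤ (2 : ℝ) ^ k then ‖𝓕⁻ (fun ξ : ℝ =>
      ((ψ (ξ / 2 ^ k) - ψ (ξ / 2 ^ (k - 1)) : ℝ) : ℂ) *
        Complex.exp (Complex.I * t * (|ξ| ^ ((1 : ℝ) / 2) : ℝ)) * 𝓕 (⇑φ) ξ) x‖ else 0) ≤
      4 * A * (if L ≤ 2 ^ k then (√2)⁻¹ ^ k else 0) := by
    intro k
    split_ifs
    · exact (hpiece k).trans_eq (by ring)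
    · simp
  have hs' := hs.mul_left (4 * A)
  calc _ ≤ ∑' k : ℤ, 4 * A * (if L ≤ 2 ^ k then (√2)⁻¹ ^ k else 0) :=
        (Summable.of_nonneg_of_le (fun k => by split_ifs <;> positivity) hterm hs').tsum_le_tsum
          hterm hs'
    _ ≤ 4 * A * ((1 - (√2)⁻¹)⁻¹ * L ^ (-(1 : ℝ) / 2)) := by
        rw [tsum_mul_left]
        gcongr
    _ = 4 * (1 - (√2)⁻¹)⁻¹ * ((2 : ℝ) ^ (-10 : ℤ)) ^ (-(1 : ℝ) / 2) *
          (1 + |t|) ^ (-(1 : ℝ) / 2) * A := by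
        rw [hLdef, Real.mul_rpow (by positivity) (by positivity)]
        ring
    _ ≤ _ := by
        gcongr
        linarith
end
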